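/- arXiv:2202.01959 — 8 statements merged into one kernel-verified Lean document; each statement's English description precedes it below -/
import Mathlib

section
/- Let u_n denote the number of isomorphism classes of FAS structures with exactly n elements and let Q(n,n) = (n-1)((n-1)² + 3n - 1)/6. Then u_n·(n-1)!/2^{Q(n,n)} tends to 1 as n → ∞; that is, 2^{Q(n,n)}/(n-1)! is an asymptotic formula for the number of n-atom nonassociative relation algebras. -/
open Filter Topology

/-- Labelled FAS-type data on the universe `Fin n`: a unary function `f`,
a set `I` of identity atoms, and a ternary relation `T`. -/
abbrev FASData (n : ℕ) :=
  (Fin n → Fin n) × Finset (Fin n) × Finset (Fin n × Fin n × Fin n)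

/-- The conditions (P) and (I) defining FAS structures. -/
def IsFAS {n : ℕ} (M : FASData n) : Prop :=
  (∀ a b c : Fin n, (a, b, c) ∈ M.2.2 → (M.1 a, c, b) ∈ M.2.2 ∧ (c, M.1 b, a) ∈ M.2.2) ∧
  (∀ a b : Fin n, a = b ↔ ∃ i ∈ M.2.1, (a, i, b) ∈ M.2.2)

/-- Isomorphism of FAS structures: a bijection of the universe preserving
`f`, `I`, and `T` in both directions. -/
def FASIso {n : ℕ} (M N : FASData n) : Prop :=
  ∃ g : Fin n ≃ Fin n,
    (∀ x, g (M.1 x) = N.1 (g x)) ∧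
    (∀ x, x ∈ M.2.1 ↔ g x ∈ N.2.1) ∧
    (∀ a b c, (a, b, c) ∈ M.2.2 ↔ (g a, g b, g c) ∈ N.2.2)

/-- The number of isomorphism classes of `n`-element FAS structures,
i.e., the number of `n`-atom nonassociative relation algebras. -/
noncomputable def uCount (n : ℕ) : ℕ :=
  Nat.card (Quot fun M N : {M : FASData n // IsFAS M} => FASIso M.1 N.1)

/-- `Q(n,s) = (n-1)((n-1)² + 3s - 1)/6`; here evaluated at `s = n`.  (For `n ≥ 1` the
displayed natural-number division is exact, since `Q(n,n) = (n³ - n)/6`.) -/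
def Q (n s : ℕ) : ℕ := (n - 1) * ((n - 1) ^ 2 + 3 * s - 1) / 6

open Equiv

/-- The action of `S₃` on triples that permutes the entries and applies the involution `f` to
every entry when the permutation is odd. -/
abbrev twistedAction {V : Type*} (f : V → V) (hf : Function.Involutive f) :
    MulAction (Perm (Fin 3)) (Fin 3 → V) where
  smul σ v := fun i => if Perm.sign σ = 1 then v (σ⁻¹ i) else f (v (σ⁻¹ i))
  one_smul v := by
    funext i
    change (if Perm.sign (1 : Perm (Fin 3)) = 1 then _ else _) = _
    simp
  mul_smul σ τ v := by
    funext i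
    change (if Perm.sign (σ * τ) = 1 then v ((σ * τ)⁻¹ i) else f (v ((σ * τ)⁻¹ i))) =
      if Perm.sign σ = 1 then
        (if Perm.sign τ = 1 then v (τ⁻¹ (σ⁻¹ i)) else f (v (τ⁻¹ (σ⁻¹ i))))
      else f (if Perm.sign τ = 1 then v (τ⁻¹ (σ⁻¹ i)) else f (v (τ⁻¹ (σ⁻¹ i))))
    rw [Perm.sign_mul]
    rcases Int.units_eq_one_or (Perm.sign σ) with h | h <;>
      rcases Int.units_eq_one_or (Perm.sign τ) with h' | h' <;>
      simp [h, h', mul_inv_rev, hf (v _)]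

/-- The setoid of orbits of `twistedAction`. -/
abbrev twistedSetoid {V : Type*} (f : V → V) (hf : Function.Involutive f) : Setoid (Fin 3 → V) :=
  @MulAction.orbitRel (Perm (Fin 3)) (Fin 3 → V) _ (twistedAction f hf)

theorem univ_perm_fin_three : (Finset.univ : Finset (Perm (Fin 3))) =
    {1, swap 0 1, swap 0 2, swap 1 2, swap 0 1 * swap 1 2, swap 1 2 * swap 0 1} := by
  decide

theorem twistedSetoid_iff {V : Type*} (f : V → V) (hf : Function.Involutive f) (a b c x y z : V) :
    (twistedSetoid f hf) ![a, b, c] ![x, y, z] ↔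
      (a = x ∧ b = y ∧ c = z) ∨ (a = f y ∧ b = f x ∧ c = f z) ∨ (a = f z ∧ b = f y ∧ c = f x) ∨
      (a = f x ∧ b = f z ∧ c = f y) ∨ (a = z ∧ b = x ∧ c = y) ∨ (a = y ∧ b = z ∧ c = x) := by
  let _ := twistedAction f hf
  have key : ∀ σ : Perm (Fin 3), σ • ![x, y, z] = ![a, b, c] ↔
      ∀ i, (if Perm.sign σ = 1 then ![x, y, z] (σ⁻¹ i) else f (![x, y, z] (σ⁻¹ i))) = ![a, b, c] i :=
    fun σ => funext_iff
  have h1 : (twistedSetoid f hf) ![a, b, c] ![x, y, z] ↔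
      ∃ σ : Perm (Fin 3), σ • ![x, y, z] = ![a, b, c] := Iff.rfl
  have e1 : swap (0 : Fin 3) 1 2 = 2 := by decide
  have e2 : swap (0 : Fin 3) 2 1 = 1 := by decide
  have e3 : swap (1 : Fin 3) 2 0 = 0 := by decide
  have h2 : (∃ σ : Perm (Fin 3), σ • ![x, y, z] = ![a, b, c]) ↔
      ∃ σ ∈ (Finset.univ : Finset (Perm (Fin 3))), σ • ![x, y, z] = ![a, b, c] := by simp
  rw [h1, h2, univ_perm_fin_three]
  simp only [key, Finset.mem_insert, Finset.mem_singleton, exists_eq_or_imp, exists_eq_left]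
  simp [Fin.forall_fin_succ, e1, e2, e3, eq_comm (a := a), eq_comm (a := b),
    eq_comm (a := c)]

theorem card_twisted_orbits {V : Type*} [Fintype V] [DecidableEq V] (f : V → V)
    (hf : Function.Involutive f) :
    6 * Nat.card (Quotient (twistedSetoid f hf)) =
      Fintype.card V ^ 3 + 3 * (Fintype.card {x // f x = x} * Fintype.card V)
        + 2 * Fintype.card V := by
  classical
  let _ := twistedAction f hf
  have burnside := MulAction.sum_card_fixedBy_eq_card_orbits_mul_card_group
    (Perm (Fin 3)) (Fin 3 → V)
  have hsmul : ∀ (σ : Perm (Fin 3)) (v : Fin 3 → V), v ∈ MulAction.fixedBy (Fin 3 → V) σ ↔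
      ∀ i, (if Perm.sign σ = 1 then v (σ⁻¹ i) else f (v (σ⁻¹ i))) = v i := fun σ v => funext_iff
  have e1 : swap (0 : Fin 3) 1 2 = 2 := by decide
  have e2 : swap (0 : Fin 3) 2 1 = 1 := by decide
  have e3 : swap (1 : Fin 3) 2 0 = 0 := by decide
  have h01 : Fintype.card (MulAction.fixedBy (Fin 3 → V) (swap (0 : Fin 3) 1)) =
      Fintype.card {x // f x = x} * Fintype.card V := by
    rw [← Fintype.card_prod]
    refine Fintype.card_congr ⟨fun v => (⟨v.1 2, ?_⟩, v.1 0), fun p => ⟨![p.2, f p.2, p.1], ?_⟩,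
      fun v => ?_, fun p => ?_⟩
    · have := (hsmul _ _).1 v.2 2
      simpa [e1] using this
    · rw [hsmul]
      simp [Fin.forall_fin_succ, e1, hf p.2, p.1.2]
    · have := (hsmul _ _).1 v.2 1
      ext i
      fin_cases i <;> simp_all
    · simp
  have h02 : Fintype.card (MulAction.fixedBy (Fin 3 → V) (swap (0 : Fin 3) 2)) =
      Fintype.card {x // f x = x} * Fintype.card V := by
    rw [← Fintype.card_prod]
    refine Fintype.card_congr ⟨fun v => (⟨v.1 1, ?_⟩, v.1 0), fun p => ⟨![p.2, p.1, f p.2], ?_⟩,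
      fun v => ?_, fun p => ?_⟩
    · have := (hsmul _ _).1 v.2 1
      simpa [e2] using this
    · rw [hsmul]
      simp [Fin.forall_fin_succ, e2, hf p.2, p.1.2]
    · have := (hsmul _ _).1 v.2 2
      ext i
      fin_cases i <;> simp_all
    · simp
  have h12 : Fintype.card (MulAction.fixedBy (Fin 3 → V) (swap (1 : Fin 3) 2)) =
      Fintype.card {x // f x = x} * Fintype.card V := by
    rw [← Fintype.card_prod]
    refine Fintype.card_congr ⟨fun v => (⟨v.1 0, ?_⟩, v.1 1), fun p => ⟨![p.1, p.2, f p.2], ?_⟩,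
      fun v => ?_, fun p => ?_⟩
    · have := (hsmul _ _).1 v.2 0
      simpa [e3] using this
    · rw [hsmul]
      simp [Fin.forall_fin_succ, e3, hf p.2, p.1.2]
    · have := (hsmul _ _).1 v.2 2
      ext i
      fin_cases i <;> simp_all
    · simp
  have hc : Fintype.card (MulAction.fixedBy (Fin 3 → V) (swap (0 : Fin 3) 1 * swap 1 2)) =
      Fintype.card V := by
    refine Fintype.card_congr ⟨fun v => v.1 0, fun x => ⟨fun _ => x, ?_⟩, fun v => ?_, fun p => ?_⟩
    · rw [hsmul]
      simp
    · have h0 := (hsmul _ _).1 v.2 1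
      have h1 := (hsmul _ _).1 v.2 2
      ext i
      fin_cases i <;> simp_all
    · simp
  have hc' : Fintype.card (MulAction.fixedBy (Fin 3 → V) (swap (1 : Fin 3) 2 * swap 0 1)) =
      Fintype.card V := by
    refine Fintype.card_congr ⟨fun v => v.1 0, fun x => ⟨fun _ => x, ?_⟩, fun v => ?_, fun p => ?_⟩
    · rw [hsmul]
      simp
    · have h0 := (hsmul _ _).1 v.2 1
      have h1 := (hsmul _ _).1 v.2 2
      ext i
      fin_cases i <;> simp_all
    · simp
  have h1 : Fintype.card (MulAction.fixedBy (Fin 3 → V) (1 : Perm (Fin 3))) =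
      Fintype.card V ^ 3 := by
    simp [MulAction.fixedBy_one_eq_univ]
  rw [univ_perm_fin_three, Finset.sum_insert (by decide), Finset.sum_insert (by decide),
    Finset.sum_insert (by decide), Finset.sum_insert (by decide), Finset.sum_insert (by decide),
    Finset.sum_singleton, h1, h01, h02, h12, hc, hc', Fintype.card_perm, Fintype.card_fin] at burnside
  simp only [Nat.factorial] at burnside
  change 6 * Nat.card (Quotient (MulAction.orbitRel (Perm (Fin 3)) (Fin 3 → V))) = _
  rw [Nat.card_eq_fintype_card]
  omega

theorem two_mul_card_sameCycle_quotient {Ω : Type*} [Finite Ω] (π : Perm Ω) :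
    2 * Nat.card (Quotient (Perm.SameCycle.setoid π)) + Nat.card {x // π x ≠ x} ≤
      2 * Nat.card Ω := by
  classical
  have hle : Nat.card (Quotient (Perm.SameCycle.setoid π) ⊕ Quotient (Perm.SameCycle.setoid π)) ≤
      Nat.card (Ω ⊕ {x // π x = x}) := by
    refine Nat.card_le_card_of_injective
      (Sum.elim (fun q => Sum.inl q.out)
        (fun q => if h : π q.out = q.out then Sum.inr ⟨q.out, h⟩ else Sum.inl (π q.out))) ?_
    have hout : ∀ q q' : Quotient (Perm.SameCycle.setoid π), q.out = q'.out → q = q' :=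
      fun q q' h => Quotient.out_injective h
    have hstep : ∀ q q' : Quotient (Perm.SameCycle.setoid π), π q.out = q'.out → q = q' := by
      intro q q' h
      rw [← q.out_eq, ← q'.out_eq]
      exact Quotient.sound (h ▸ (Perm.sameCycle_apply_right.2 (Perm.SameCycle.refl π q.out)))
    rintro (q | q) (q' | q') h
    · simp only [Sum.elim_inl, Sum.inl.injEq] at h
      rw [hout _ _ h]
    · simp only [Sum.elim_inl, Sum.elim_inr] at h
      split_ifs at h with h'
      simp only [Sum.inl.injEq] at h
      have := hstep _ _ h.symm
      subst this
      exact absurd h.symm h'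
    · simp only [Sum.elim_inl, Sum.elim_inr] at h
      split_ifs at h with h'
      simp only [Sum.inl.injEq] at h
      have := hstep _ _ h
      subst this
      exact absurd h h'
    · simp only [Sum.elim_inr] at h
      split_ifs at h with h₁ h₂
      · simp only [Sum.inr.injEq, Subtype.mk.injEq] at h
        rw [hout _ _ h]
      · simp only [Sum.inl.injEq] at h
        rw [hout _ _ (π.injective h)]
  have hsum : Nat.card {x // π x = x} + Nat.card {x // π x ≠ x} = Nat.card Ω := by
    rw [← Nat.card_sum]
    exact Nat.card_congr (Equiv.sumCompl (fun x => π x = x))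
  rw [Nat.card_sum, Nat.card_sum] at hle
  omega

/-- The permutation of the twisted orbits induced by a permutation commuting with `f`. -/
def orbitPerm {V : Type*} (f : V → V) (hf : Function.Involutive f) (g : Perm V)
    (hg : ∀ x, g (f x) = f (g x)) : Perm (Quotient (twistedSetoid f hf)) :=
  Quotient.congr (Equiv.arrowCongr (Equiv.refl (Fin 3)) g) fun v w => by
    have hv : ∀ u : Fin 3 → V, u = ![u 0, u 1, u 2] := fun u => by
      ext i; fin_cases i <;> rfl
    have hg' : ∀ u : Fin 3 → V, Equiv.arrowCongr (Equiv.refl (Fin 3)) g u =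
        ![g (u 0), g (u 1), g (u 2)] := fun u => by
      ext i; fin_cases i <;> rfl
    rw [hg' v, hg' w, hv v, hv w, twistedSetoid_iff, twistedSetoid_iff]
    simp [← hg]

theorem orbitPerm_mk {V : Type*} (f : V → V) (hf : Function.Involutive f) (g : Perm V)
    (hg : ∀ x, g (f x) = f (g x)) (v : Fin 3 → V) :
    orbitPerm f hf g hg (Quotient.mk _ v) = Quotient.mk _ (fun i => g (v i)) := rfl

theorem card_sq_le_moved_orbits {V : Type*} [Fintype V] (f : V → V)
    (hf : Function.Involutive f) (g : Perm V) (hg : ∀ x, g (f x) = f (g x)) (hne : g ≠ 1) :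
    Fintype.card V ^ 2 ≤ 5 * Fintype.card V +
      6 * Nat.card {ω : Quotient (twistedSetoid f hf) // orbitPerm f hf g hg ω ≠ ω} := by
  classical
  obtain ⟨x, hx⟩ : ∃ x, g x ≠ x := by
    by_contra! h
    exact hne (Equiv.ext h)
  set F : V × V → Quotient (twistedSetoid f hf) := fun p => Quotient.mk _ ![x, p.1, p.2] with hF
  set good : Finset (V × V) := Finset.univ.filter fun p => orbitPerm f hf g hg (F p) ≠ F p
    with hgood
  have hbad : (Finset.univ.filter fun p => ¬ orbitPerm f hf g hg (F p) ≠ F p).card ≤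
      5 * Fintype.card V := by
    have hsub : (Finset.univ.filter fun p => ¬ orbitPerm f hf g hg (F p) ≠ F p) ⊆
        (Finset.univ : Finset (Fin 5 × V)).image fun p =>
          ![(f (g x), p.2), (p.2, f (g x)), (p.2, f (g p.2)), (p.2, g x), (g x, p.2)] p.1 := by
      rintro ⟨b, c⟩ hp
      simp only [ne_eq, not_not, Finset.mem_filter, Finset.mem_univ, true_and, hF,
        orbitPerm_mk] at hp
      have hp' := Quotient.exact hp
      have hvec : (fun i => g (![x, b, c] i)) = ![g x, g b, g c] := by
        ext i; fin_cases i <;> rfl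
      rw [hvec] at hp'
      have hp2 := (twistedSetoid_iff f hf _ _ _ _ _ _).1 hp'
      simp only [Finset.mem_image, Finset.mem_univ, true_and, Prod.exists]
      rcases hp2 with h | h | h | h | h | h
      · exact absurd h.1 hx
      · exact ⟨0, c, by simp [h.1, hf b]⟩
      · exact ⟨1, b, by simp [h.1, hf c]⟩
      · exact ⟨2, b, by simp [h.2.1, hf c]⟩
      · exact ⟨3, b, by simp [h.1]⟩
      · exact ⟨4, c, by simp [h.1]⟩
    refine (Finset.card_le_card hsub).trans (Finset.card_image_le.trans ?_)
    simp
  have hsplit : good.card + (Finset.univ.filter fun p =>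
      ¬ orbitPerm f hf g hg (F p) ≠ F p).card = Fintype.card V ^ 2 := by
    rw [hgood, Finset.card_filter_add_card_filter_not, Finset.card_univ, Fintype.card_prod, sq]
  have himage : good.card ≤ 6 * (good.image F).card := by
    refine Finset.card_le_mul_card_image _ _ fun ω hω => ?_
    obtain ⟨⟨b, c⟩, -, rfl⟩ := Finset.mem_image.1 hω
    have hsub : good.filter (fun p => F p = F (b, c)) ⊆
        {(b, c), (f x, f c), (f b, f x), (f c, f b), (x, b), (c, x)} := by
      rintro ⟨b', c'⟩ hp
      have h := (twistedSetoid_iff f hf _ _ _ _ _ _).1 (Quotient.exact (Finset.mem_filter.1 hp).2)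
      simp only [Finset.mem_insert, Finset.mem_singleton, Prod.mk.injEq]
      tauto
    exact (Finset.card_le_card hsub).trans Finset.card_le_six
  have hmoved : (good.image F).card ≤
      Nat.card {ω : Quotient (twistedSetoid f hf) // orbitPerm f hf g hg ω ≠ ω} := by
    rw [Nat.card_eq_fintype_card, Fintype.card_subtype]
    refine Finset.card_le_card fun ω hω => ?_
    obtain ⟨p, hp, rfl⟩ := Finset.mem_image.1 hω
    simpa [hgood] using hp
  omega

namespace IsFAS

variable {n : ℕ} {M : FASData n}

theorem involutive (h : IsFAS M) : Function.Involutive M.1 := by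
  intro a
  obtain ⟨i, hi, hai⟩ := (h.2 a a).1 rfl
  exact (h.2 _ _).2 ⟨i, hi, (h.1 _ _ _ (h.1 _ _ _ hai).1).1⟩

theorem map_identity (h : IsFAS M) {i : Fin n} (hi : i ∈ M.2.1) : M.1 i = i := by
  obtain ⟨k, -, hk⟩ := (h.2 i i).1 rfl
  have h₁ : M.1 i = k := (h.2 _ _).2 ⟨i, hi, (h.1 _ _ _ hk).1⟩
  subst h₁
  have h₂ := (h.1 _ _ _ hk).2
  rw [h.involutive i] at h₂
  exact (h.2 _ _).2 ⟨i, hi, (h.1 _ _ _ h₂).1⟩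

theorem map_notMem (h : IsFAS M) {x : Fin n} (hx : x ∉ M.2.1) : M.1 x ∉ M.2.1 := by
  intro hfx
  have := h.map_identity hfx
  rw [h.involutive x] at this
  exact hx (this ▸ hfx)

theorem swap_right (h : IsFAS M) {a b c : Fin n} (ht : (a, b, c) ∈ M.2.2) :
    (M.1 a, c, b) ∈ M.2.2 := (h.1 _ _ _ ht).1

theorem swap_outer (h : IsFAS M) {a b c : Fin n} (ht : (a, b, c) ∈ M.2.2) :
    (c, M.1 b, a) ∈ M.2.2 := (h.1 _ _ _ ht).2

theorem rotate (h : IsFAS M) {a b c : Fin n} (ht : (a, b, c) ∈ M.2.2) :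
    (M.1 c, a, M.1 b) ∈ M.2.2 := h.swap_right (h.swap_outer ht)

theorem rotate' (h : IsFAS M) {a b c : Fin n} (ht : (a, b, c) ∈ M.2.2) :
    (b, M.1 c, M.1 a) ∈ M.2.2 := h.swap_outer (h.swap_right ht)

theorem swap_left (h : IsFAS M) {a b c : Fin n} (ht : (a, b, c) ∈ M.2.2) :
    (M.1 b, M.1 a, M.1 c) ∈ M.2.2 := h.swap_right (h.rotate' ht)

/-- The restriction of the converse map to the non-identity atoms. -/
def restrict (h : IsFAS M) (x : {x // x ∉ M.2.1}) : {x // x ∉ M.2.1} :=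
  ⟨M.1 x, h.map_notMem x.2⟩

theorem restrict_involutive (h : IsFAS M) : Function.Involutive h.restrict :=
  fun x => Subtype.ext (h.involutive x)

/-- Membership in `T` for triples of non-identity atoms, in the coordinates for which the
Peircean transformations become `twistedAction`. -/
def core (M : FASData n) (v : Fin 3 → {x // x ∉ M.2.1}) : Prop :=
  ((v 0 : Fin n), (v 1 : Fin n), M.1 (v 2)) ∈ M.2.2

theorem core_congr (h : IsFAS M) (v w : Fin 3 → {x // x ∉ M.2.1})
    (hvw : twistedSetoid h.restrict h.restrict_involutive v w) : core M v = core M w := by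
  have key : ∀ v w : Fin 3 → {x // x ∉ M.2.1},
      twistedSetoid h.restrict h.restrict_involutive v w → core M w → core M v := by
    intro v w hvw hw
    have hv' : ∀ u : Fin 3 → {x // x ∉ M.2.1}, u = ![u 0, u 1, u 2] := fun u => by
      ext i; fin_cases i <;> rfl
    rw [hv' v, hv' w, twistedSetoid_iff] at hvw
    unfold core at hw ⊢
    have inv := h.involutive
    rcases hvw with e | e | e | e | e | e <;> rw [e.1, e.2.1, e.2.2]
    · exact hw
    · simpa [restrict, inv _] using h.swap_left hw
    · simpa [restrict, inv _] using h.swap_outer hw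
    · simpa [restrict, inv _] using h.swap_right hw
    · simpa [restrict, inv _] using h.rotate hw
    · simpa [restrict, inv _] using h.rotate' hw
  exact propext ⟨key _ _ (Setoid.symm' _ hvw), key _ _ hvw⟩

theorem subset_of_core {f : Fin n → Fin n} {I : Finset (Fin n)}
    {T T' : Finset (Fin n × Fin n × Fin n)} (h : IsFAS (f, I, T)) (h' : IsFAS (f, I, T'))
    (hcore : core (f, I, T) = core (f, I, T'))
    (hid : ∀ a, ∀ i ∈ I, (a, i, a) ∈ T → (a, i, a) ∈ T') : T ⊆ T' := by
  have inv : ∀ x, f (f x) = x := h.involutive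
  have base : ∀ a c : Fin n, ∀ i ∈ I, (a, i, c) ∈ T → (a, i, c) ∈ T' := by
    intro a c i hi ht
    have hac : a = c := (h.2 a c).2 ⟨i, hi, ht⟩
    subst hac
    exact hid a i hi ht
  rintro ⟨a, b, c⟩ ht
  by_cases hb : b ∈ I
  · exact base _ _ _ hb ht
  by_cases hc : c ∈ I
  · have := h'.swap_right (base _ _ _ hc (h.swap_right ht))
    simpa [inv] using this
  by_cases ha : a ∈ I
  · have := h'.rotate' (base _ _ _ ha (h.rotate ht))
    simpa [inv] using this
  have hfc : f c ∉ I := h.map_notMem hc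
  have hv := congrFun hcore ![⟨a, ha⟩, ⟨b, hb⟩, ⟨f c, hfc⟩]
  have hv' : ((a, b, f (f c)) ∈ T) = ((a, b, f (f c)) ∈ T') := hv
  rw [inv] at hv'
  exact hv' ▸ ht

theorem eq_of_core {f : Fin n → Fin n} {I : Finset (Fin n)}
    {T T' : Finset (Fin n × Fin n × Fin n)} (h : IsFAS (f, I, T)) (h' : IsFAS (f, I, T'))
    (hcore : core (f, I, T) = core (f, I, T'))
    (hid : ∀ a, ∀ i ∈ I, (a, i, a) ∈ T ↔ (a, i, a) ∈ T') : T = T' :=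
  (subset_of_core h h' hcore fun a i hi => (hid a i hi).1).antisymm
    (subset_of_core h' h hcore.symm fun a i hi => (hid a i hi).2)

theorem identity_mem {f : Fin n → Fin n} {e : Fin n} {T : Finset (Fin n × Fin n × Fin n)}
    (h : IsFAS (f, {e}, T)) (a : Fin n) : (a, e, a) ∈ T := by
  obtain ⟨i, hi, ht⟩ := (h.2 a a).1 rfl
  rw [Finset.mem_singleton.1 hi] at ht
  exact ht

end IsFAS

/-- `g` is an isomorphism from `M` to `N`. -/
def IsoVia {n : ℕ} (g : Perm (Fin n)) (M N : FASData n) : Prop :=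
  (∀ x, g (M.1 x) = N.1 (g x)) ∧ (∀ x, x ∈ M.2.1 ↔ g x ∈ N.2.1) ∧
    (∀ a b c, (a, b, c) ∈ M.2.2 ↔ (g a, g b, g c) ∈ N.2.2)

theorem six_mul_Q (v : ℕ) : 6 * Q (v + 1) (v + 1) = v ^ 3 + 3 * (v * v) + 2 * v := by
  have h := card_twisted_orbits (V := Fin v) id (fun _ => rfl)
  have hs : Fintype.card {x : Fin v // id x = x} = v := by simp
  rw [hs, Fintype.card_fin] at h
  have e : (v + 1 - 1) * ((v + 1 - 1) ^ 2 + 3 * (v + 1) - 1) = v ^ 3 + 3 * (v * v) + 2 * v := by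
    have : (v + 1 - 1) ^ 2 + 3 * (v + 1) - 1 = v ^ 2 + 3 * v + 2 := by
      simp only [Nat.add_sub_cancel]; omega
    rw [this, Nat.add_sub_cancel]
    ring
  rw [Q, e]
  omega

theorem card_le_two_pow_of_predicates {α Ω : Type*} [Finite Ω] (r : α → Ω → Prop)
    (hr : ∀ a b, r a = r b → a = b) : Nat.card α ≤ 2 ^ Nat.card Ω := by
  have := Nat.card_le_card_of_injective r hr
  simpa [Nat.card_fun] using this

/-- For prescribed `f` and `I`, `T` is determined by the triples `(a, i, a)` with `i ∈ I` and the
twisted orbits of triples of non-identity atoms that it contains. -/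
theorem card_T_le {n : ℕ} {f : Fin n → Fin n} {I : Finset (Fin n)}
    {T₀ : Finset (Fin n × Fin n × Fin n)} (h₀ : IsFAS (f, I, T₀)) :
    Nat.card {T // IsFAS (f, I, T)} ≤ 2 ^ (I.card * n) *
      2 ^ Nat.card (Quotient (twistedSetoid h₀.restrict h₀.restrict_involutive)) := by
  have hle : Nat.card {T // IsFAS (f, I, T)} ≤ Nat.card ((I × Fin n → Prop) ×
      (Quotient (twistedSetoid h₀.restrict h₀.restrict_involutive) → Prop)) := by
    refine Nat.card_le_card_of_injective (fun T => (fun p => (p.2, p.1.1, p.2) ∈ T.1,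
      Quotient.lift (IsFAS.core (f, I, T.1)) (IsFAS.core_congr T.2))) ?_
    rintro ⟨T, hT⟩ ⟨T', hT'⟩ h
    simp only [Prod.mk.injEq] at h
    refine Subtype.ext (IsFAS.eq_of_core hT hT' ?_ fun a i hi => ?_)
    · funext v
      exact congrFun h.2 (Quotient.mk _ v)
    · exact iff_of_eq (congrFun h.1 (⟨i, hi⟩, a))
  simpa [Nat.card_prod, Nat.card_fun] using hle

theorem card_T_le_of_singleton {n : ℕ} {f : Fin n → Fin n} {e : Fin n}
    {T₀ : Finset (Fin n × Fin n × Fin n)} (h₀ : IsFAS (f, {e}, T₀)) :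
    Nat.card {T // IsFAS (f, {e}, T)} ≤
      2 ^ Nat.card (Quotient (twistedSetoid h₀.restrict h₀.restrict_involutive)) := by
  refine card_le_two_pow_of_predicates (fun T : {T // IsFAS (f, {e}, T)} =>
    Quotient.lift (IsFAS.core (f, {e}, T.1)) (IsFAS.core_congr T.2)) ?_
  rintro ⟨T, hT⟩ ⟨T', hT'⟩ h
  refine Subtype.ext (IsFAS.eq_of_core hT hT' ?_ fun a i hi => ?_)
  · funext v
    exact congrFun h (Quotient.mk _ v)
  · rw [Finset.mem_singleton.1 hi]
    exact iff_of_true (hT.identity_mem a) (hT'.identity_mem a)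

theorem card_T_le_of_automorphism {n : ℕ} {f : Fin n → Fin n} {e : Fin n} {g : Perm (Fin n)}
    {T₀ : Finset (Fin n × Fin n × Fin n)} (h₀ : IsFAS (f, {e}, T₀))
    (g' : Perm {x // x ∉ ({e} : Finset (Fin n))})
    (hg' : ∀ x, (g' x : Fin n) = g x)
    (hcomm : ∀ x, g' (h₀.restrict x) = h₀.restrict (g' x)) :
    Nat.card {T // IsFAS (f, {e}, T) ∧ IsoVia g (f, {e}, T) (f, {e}, T)} ≤
      2 ^ Nat.card (Quotient (Perm.SameCycle.setoid
        (orbitPerm h₀.restrict h₀.restrict_involutive g' hcomm))) := by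
  set π := orbitPerm h₀.restrict h₀.restrict_involutive g' hcomm with hπ
  let F : {T // IsFAS (f, {e}, T) ∧ IsoVia g (f, {e}, T) (f, {e}, T)} →
      Quotient (twistedSetoid h₀.restrict h₀.restrict_involutive) → Prop :=
    fun T => Quotient.lift (IsFAS.core (f, {e}, T.1)) (IsFAS.core_congr T.2.1)
  have hF : ∀ T ω, F T (π ω) = F T ω := by
    intro T ω
    induction ω using Quotient.inductionOn with
    | h v =>
      rw [hπ, orbitPerm_mk]
      have hiso := T.2.2
      refine propext ?_
      change ((g' (v 0) : Fin n), (g' (v 1) : Fin n), f (g' (v 2))) ∈ T.1 ↔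
        ((v 0 : Fin n), (v 1 : Fin n), f (v 2)) ∈ T.1
      rw [hg', hg', hg', ← show g (f _) = f (g _) from hiso.1 _]
      exact (hiso.2.2 _ _ _).symm
  have hcyc : ∀ T ω ω', Perm.SameCycle π ω ω' → F T ω = F T ω' := by
    rintro T ω ω' ⟨k, rfl⟩
    have hinv : ∀ (k : ℕ) (ω), F T ((π ^ k) ω) = F T ω := by
      intro k
      induction k with
      | zero => simp
      | succ k ih => intro ω; rw [pow_succ', Perm.mul_apply, hF, ih]
    rcases k with k | k
    · exact (hinv k ω).symm
    · have := hinv (k + 1) ((π ^ (Int.negSucc k)) ω)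
      rw [zpow_negSucc, ← Perm.mul_apply, mul_inv_cancel, Perm.one_apply] at this
      rw [zpow_negSucc]
      exact this
  refine card_le_two_pow_of_predicates (fun T => Quotient.lift (F T) (hcyc T)) ?_
  rintro ⟨T, hT⟩ ⟨T', hT'⟩ h
  refine Subtype.ext (IsFAS.eq_of_core hT.1 hT'.1 ?_ fun a i hi => ?_)
  · funext v
    exact congrFun h (Quotient.mk _ (Quotient.mk _ v))
  · rw [Finset.mem_singleton.1 hi]
    exact iff_of_true (hT.1.identity_mem a) (hT'.1.identity_mem a)

theorem card_mul_two_pow_le_of_two_le {n : ℕ} (hn : 12 ≤ n) (f : Fin n → Fin n)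
    (I : Finset (Fin n)) (hI : 2 ≤ I.card) {D : ℕ} (hD : 6 * D + 3 * n ≤ n ^ 2) :
    Nat.card {T // IsFAS (f, I, T)} * 2 ^ D ≤ 2 ^ Q n n := by
  rcases isEmpty_or_nonempty {T // IsFAS (f, I, T)} with hemp | ⟨⟨T₀, h₀⟩⟩
  · simp
  refine (Nat.mul_le_mul_right _ (card_T_le h₀)).trans ?_
  rw [← pow_add, ← pow_add]
  refine Nat.pow_le_pow_right two_pos ?_
  have hN := card_twisted_orbits h₀.restrict h₀.restrict_involutive
  set N := Nat.card (Quotient (twistedSetoid h₀.restrict h₀.restrict_involutive))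
  have hs := Fintype.card_subtype_le (fun x => h₀.restrict x = x)
  have hv : Fintype.card {x // x ∉ I} + I.card = n := by
    have := Fintype.card_subtype_compl (fun x => x ∈ I)
    have h2 := Finset.card_le_univ I
    simp only [Fintype.card_fin, Fintype.card_coe] at this h2
    omega
  have hN' : 6 * N ≤ Fintype.card {x // x ∉ I} ^ 3 +
      3 * (Fintype.card {x // x ∉ I} * Fintype.card {x // x ∉ I}) +
        2 * Fintype.card {x // x ∉ I} := by
    rw [hN]
    gcongr
  generalize Fintype.card {x // x ∉ I} = m at hv hN'
  generalize I.card = j at hv hI ⊢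
  obtain ⟨v, rfl⟩ : ∃ v, n = v + 1 := ⟨n - 1, by omega⟩
  have hQ := six_mul_Q v
  have key : 6 * (j * (v + 1)) + (m ^ 3 + 3 * (m * m) + 2 * m) + ((v + 1) ^ 2 - 3 * (v + 1)) ≤
      v ^ 3 + 3 * (v * v) + 2 * v := by
    zify [show 3 * (v + 1) ≤ (v + 1) ^ 2 by omega]
    obtain ⟨i, rfl⟩ : ∃ i, j = i + 2 := ⟨j - 2, by omega⟩
    have hv' : v = m + i + 1 := by omega
    have h12 : (11 : ℤ) ≤ m + i + 1 := by omega
    subst hv'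
    push_cast
    have hm : (0 : ℤ) ≤ m := by positivity
    have hi : (0 : ℤ) ≤ i := by positivity
    generalize (m : ℤ) = m at *
    generalize (i : ℤ) = i at *
    nlinarith [mul_nonneg hm hi, mul_nonneg (mul_nonneg hm hi) hm, mul_nonneg (mul_nonneg hm hi) hi,
      mul_nonneg hm (sub_nonneg.2 h12), mul_nonneg hi (sub_nonneg.2 h12),
      mul_nonneg (mul_nonneg hi hi) (sub_nonneg.2 h12),
      mul_nonneg (mul_nonneg hm hi) (sub_nonneg.2 h12)]
  omega

theorem card_compl_singleton {n : ℕ} (e : Fin n) :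
    Fintype.card {x // x ∉ ({e} : Finset (Fin n))} = n - 1 := by
  simp

theorem card_mul_two_pow_le_of_singleton {n : ℕ} (f : Fin n → Fin n) (e : Fin n) :
    Nat.card {T // IsFAS (f, {e}, T)} * 2 ^ (Fintype.card {x // f x ≠ x} * ((n - 1) / 2)) ≤
      2 ^ Q n n := by
  rcases isEmpty_or_nonempty {T // IsFAS (f, {e}, T)} with hemp | ⟨⟨T₀, h₀⟩⟩
  · simp
  refine (Nat.mul_le_mul_right _ (card_T_le_of_singleton h₀)).trans ?_
  rw [← pow_add]
  refine Nat.pow_le_pow_right two_pos ?_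
  have hN := card_twisted_orbits h₀.restrict h₀.restrict_involutive
  set N := Nat.card (Quotient (twistedSetoid h₀.restrict h₀.restrict_involutive))
  have hs : Fintype.card {x // h₀.restrict x = x} + Fintype.card {x // f x ≠ x} = n - 1 := by
    have h1 : Fintype.card {x // f x ≠ x} = Fintype.card {x // h₀.restrict x ≠ x} := by
      refine Fintype.card_congr ⟨fun x => ⟨⟨x.1, fun hx => x.2 (h₀.map_identity hx)⟩,
        fun h => x.2 (congrArg Subtype.val h)⟩,
        fun x => ⟨x.1.1, fun h => x.2 (Subtype.ext h)⟩, fun x => rfl, fun x => rfl⟩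
    rw [h1, ← card_compl_singleton e, ← Fintype.card_sum]
    exact Fintype.card_congr (Equiv.sumCompl fun x => h₀.restrict x = x)
  have hcard : Fintype.card {x // x ∉ (f, ({e} : Finset (Fin n)), T₀).2.1} = n - 1 :=
    card_compl_singleton e
  rw [hcard] at hN
  obtain ⟨v, rfl⟩ : ∃ v, n = v + 1 := ⟨n - 1, by have := e.pos; omega⟩
  have hQ := six_mul_Q v
  simp only [Nat.add_sub_cancel] at *
  generalize Fintype.card {x // h₀.restrict x = x} = s at *
  generalize Fintype.card {x // f x ≠ x} = k at *
  have h1 : k * (v / 2) * 2 ≤ k * v := by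
    rw [mul_assoc]
    exact Nat.mul_le_mul_left _ (Nat.div_mul_le_self v 2)
  have h2 : s * v + k * v = v * v := by rw [← add_mul, hs]
  omega

theorem card_automorphic_mul_two_pow_le {n : ℕ} (f : Fin n → Fin n) (e : Fin n)
    {g : Perm (Fin n)} (hg : g ≠ 1) {D : ℕ} (hD : 12 * D + 5 * n ≤ (n - 1) ^ 2) :
    Nat.card {T // IsFAS (f, {e}, T) ∧ IsoVia g (f, {e}, T) (f, {e}, T)} * 2 ^ D ≤
      2 ^ Q n n := by
  rcases isEmpty_or_nonempty {T // IsFAS (f, {e}, T) ∧ IsoVia g (f, {e}, T) (f, {e}, T)} with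
    hemp | ⟨⟨T₀, h₀, hiso⟩⟩
  · simp
  have hgI : ∀ x, g x ∉ ({e} : Finset (Fin n)) ↔ x ∉ ({e} : Finset (Fin n)) :=
    fun x => not_congr (hiso.2.1 x).symm
  set g' : Perm {x // x ∉ ({e} : Finset (Fin n))} := g.subtypePerm hgI with hg'
  have hcomm : ∀ x, g' (h₀.restrict x) = h₀.restrict (g' x) :=
    fun x => Subtype.ext (hiso.1 x)
  have hne : g' ≠ 1 := by
    intro h
    refine hg (Equiv.ext fun x => ?_)
    by_cases hx : x ∈ ({e} : Finset (Fin n))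
    · have hx' : g x ∈ ({e} : Finset (Fin n)) := (hiso.2.1 x).1 hx
      rw [Finset.mem_singleton] at hx hx'
      rw [hx', Perm.one_apply, hx]
    · exact congrArg Subtype.val (Equiv.ext_iff.1 h ⟨x, hx⟩)
  refine (Nat.mul_le_mul_right _
    (card_T_le_of_automorphism (g := g) h₀ g' (fun _ => rfl) hcomm)).trans ?_
  rw [← pow_add]
  refine Nat.pow_le_pow_right two_pos ?_
  have hN := card_twisted_orbits h₀.restrict h₀.restrict_involutive
  have hs := Fintype.card_subtype_le (fun x => h₀.restrict x = x)
  have hcyc := two_mul_card_sameCycle_quotient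
    (orbitPerm h₀.restrict h₀.restrict_involutive g' hcomm)
  have hmov := card_sq_le_moved_orbits h₀.restrict h₀.restrict_involutive g' hcomm hne
  have hcard : Fintype.card {x // x ∉ (f, ({e} : Finset (Fin n)), T₀).2.1} = n - 1 :=
    card_compl_singleton e
  rw [hcard] at hN hs hmov
  have hN' : 6 * Nat.card (Quotient (twistedSetoid h₀.restrict h₀.restrict_involutive)) ≤
      (n - 1) ^ 3 + 3 * ((n - 1) * (n - 1)) + 2 * (n - 1) := by
    rw [hN]
    gcongr
  obtain ⟨v, rfl⟩ : ∃ v, n = v + 1 := ⟨n - 1, by have := e.pos; omega⟩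
  have hQ := six_mul_Q v
  simp only [Nat.add_sub_cancel] at *
  omega

theorem two_pow_Q_le_card {n : ℕ} (e : Fin n) :
    2 ^ Q n n ≤ Nat.card {T // IsFAS ((id : Fin n → Fin n), {e}, T)} := by
  classical
  let V := {x : Fin n // x ≠ e}
  let s : Setoid (Fin 3 → V) := twistedSetoid (id : V → V) (fun _ => rfl)
  have hs : ∀ a b c x y z : V, (⟦![a, b, c]⟧ : Quotient s) = ⟦![x, y, z]⟧ ↔ _ :=
    fun a b c x y z => Quotient.eq.trans (twistedSetoid_iff id (fun _ => rfl) a b c x y z)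
  let R : Set (Quotient s) → Finset (Fin n × Fin n × Fin n) := fun S =>
    Finset.univ.filter fun t => (t.1 = e ∧ t.2.1 = t.2.2) ∨ (t.2.1 = e ∧ t.1 = t.2.2) ∨
      (t.2.2 = e ∧ t.1 = t.2.1) ∨ ∃ (ha : t.1 ≠ e) (hb : t.2.1 ≠ e) (hc : t.2.2 ≠ e),
        (⟦![⟨t.1, ha⟩, ⟨t.2.1, hb⟩, ⟨t.2.2, hc⟩]⟧ : Quotient s) ∈ S
  have hR : ∀ S a b c, (a, b, c) ∈ R S ↔ (a = e ∧ b = c) ∨ (b = e ∧ a = c) ∨ (c = e ∧ a = b) ∨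
      ∃ (ha : a ≠ e) (hb : b ≠ e) (hc : c ≠ e),
        (⟦![⟨a, ha⟩, ⟨b, hb⟩, ⟨c, hc⟩]⟧ : Quotient s) ∈ S := by
    intro S a b c
    simp [R]
  have hFAS : ∀ S, IsFAS ((id : Fin n → Fin n), {e}, R S) := by
    refine fun S => ⟨fun a b c h => ?_, fun a b => ?_⟩
    · replace h := (hR _ _ _ _).1 h
      have e1 : ∀ a b c : V, (⟦![a, c, b]⟧ : Quotient s) = ⟦![a, b, c]⟧ := fun a b c => by
        rw [hs]; simp
      have e2 : ∀ a b c : V, (⟦![c, b, a]⟧ : Quotient s) = ⟦![a, b, c]⟧ := fun a b c => by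
        rw [hs]; simp
      constructor
      · refine (hR _ _ _ _).2 ?_
        rcases h with h | h | h | ⟨ha, hb, hc, h⟩
        · exact Or.inl ⟨h.1, h.2.symm⟩
        · exact Or.inr (Or.inr (Or.inl h))
        · exact Or.inr (Or.inl h)
        · exact Or.inr (Or.inr (Or.inr ⟨ha, hc, hb, by rw [← e1] at h; exact h⟩))
      · refine (hR _ _ _ _).2 ?_
        rcases h with h | h | h | ⟨ha, hb, hc, h⟩
        · exact Or.inr (Or.inr (Or.inl ⟨h.1, h.2.symm⟩))
        · exact Or.inr (Or.inl ⟨h.1, h.2.symm⟩)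
        · exact Or.inl ⟨h.1, h.2.symm⟩
        · exact Or.inr (Or.inr (Or.inr ⟨hc, hb, ha, by rw [← e2] at h; exact h⟩))
    · simp only [Finset.mem_singleton, exists_eq_left, hR]
      grind
  have hinj : Function.Injective fun S =>
      (⟨R S, hFAS S⟩ : {T // IsFAS ((id : Fin n → Fin n), {e}, T)}) := by
    intro S S' h
    have h' : R S = R S' := congrArg Subtype.val h
    ext ω
    induction ω using Quotient.inductionOn with
    | h v =>
      have hv : v = ![⟨v 0, (v 0).2⟩, ⟨v 1, (v 1).2⟩, ⟨v 2, (v 2).2⟩] := by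
        ext i; fin_cases i <;> rfl
      have h3 : ∀ S, (((v 0 : Fin n), (v 1 : Fin n), (v 2 : Fin n)) ∈ R S ↔
          (⟦v⟧ : Quotient s) ∈ S) := by
        intro S
        rw [hR]
        simp only [(v 0).2, (v 1).2, (v 2).2, false_and, false_or]
        conv_rhs => rw [hv]
        exact ⟨fun ⟨_, _, _, h⟩ => h, fun h => ⟨(v 0).2, (v 1).2, (v 2).2, h⟩⟩
      rw [← h3 S, ← h3 S', h']
  have hcard := Nat.card_le_card_of_injective _ hinj
  have hN := card_twisted_orbits (id : V → V) (fun _ => rfl)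
  have hV : Fintype.card V = n - 1 := by simp [V]
  have hfix : Fintype.card {x : V // id x = x} = n - 1 := by simp [V]
  obtain ⟨v, rfl⟩ : ∃ v, n = v + 1 := ⟨n - 1, by have := e.pos; omega⟩
  have hQ := six_mul_Q v
  rw [hV, hfix, Nat.add_sub_cancel] at hN
  have hNQ : Nat.card (Quotient s) = Q (v + 1) (v + 1) := by
    change 6 * Nat.card (Quotient s) = _ at hN
    omega
  rwa [Set, Nat.card_fun, hNQ, Nat.card_eq_fintype_card, Fintype.card_prop] at hcard

/-- The image of labelled data under a permutation of the universe. -/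
def transport {n : ℕ} (g : Perm (Fin n)) (M : FASData n) : FASData n :=
  (fun x => g (M.1 (g⁻¹ x)), Finset.univ.filter fun x => g⁻¹ x ∈ M.2.1,
    Finset.univ.filter fun t => (g⁻¹ t.1, g⁻¹ t.2.1, g⁻¹ t.2.2) ∈ M.2.2)

theorem isoVia_iff_transport_eq {n : ℕ} (g : Perm (Fin n)) (M N : FASData n) :
    IsoVia g M N ↔ transport g M = N := by
  constructor
  · rintro ⟨hf, hI, hT⟩
    refine Prod.ext (funext fun x => ?_) (Prod.ext (Finset.ext fun x => ?_)
      (Finset.ext fun ⟨a, b, c⟩ => ?_))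
    · simp [transport, hf]
    · simp [transport, hI]
    · simp [transport, hT]
  · rintro rfl
    exact ⟨fun x => by simp [transport], fun x => by simp [transport], fun a b c => by simp [transport]⟩

theorem IsFAS.transport {n : ℕ} (g : Perm (Fin n)) {M : FASData n} (h : IsFAS M) :
    IsFAS (transport g M) := by
  refine ⟨fun a b c ht => ?_, fun a b => ?_⟩
  · simp only [_root_.transport, Finset.mem_filter, Finset.mem_univ, true_and] at ht ⊢
    simpa using h.1 _ _ _ ht
  · have := h.2 (g⁻¹ a) (g⁻¹ b)
    rw [(g⁻¹).injective.eq_iff] at this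
    simp only [_root_.transport, Finset.mem_filter, Finset.mem_univ, true_and]
    rw [this]
    exact ⟨fun ⟨i, hi, ht⟩ => ⟨g i, by simpa using hi, by simpa using ht⟩,
      fun ⟨i, hi, ht⟩ => ⟨g⁻¹ i, hi, ht⟩⟩

/-- The action of the permutations of the universe on FAS structures. -/
abbrev transportAction (n : ℕ) : MulAction (Perm (Fin n)) {M : FASData n // IsFAS M} where
  smul g M := ⟨transport g M.1, M.2.transport g⟩
  one_smul M := Subtype.ext ((isoVia_iff_transport_eq 1 _ _).1
    ⟨fun _ => rfl, fun _ => Iff.rfl, fun _ _ _ => Iff.rfl⟩)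
  mul_smul g g' M := Subtype.ext <| by
    change transport (g * g') M.1 = transport g (transport g' M.1)
    have h := (isoVia_iff_transport_eq g _ _).2 (rfl : transport g (transport g' M.1) = _)
    have h' := (isoVia_iff_transport_eq g' _ _).2 (rfl : transport g' M.1 = _)
    exact (isoVia_iff_transport_eq _ _ _).1
      ⟨fun x => (congrArg g (h'.1 x)).trans (h.1 _), fun x => (h'.2.1 x).trans (h.2.1 _),
        fun a b c => (h'.2.2 a b c).trans (h.2.2 _ _ _)⟩

theorem uCount_mul_factorial (n : ℕ) : uCount n * n.factorial =
    ∑ g : Perm (Fin n), Nat.card {M : FASData n // IsFAS M ∧ IsoVia g M M} := by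
  classical
  let _ := transportAction n
  have burnside := MulAction.sum_card_fixedBy_eq_card_orbits_mul_card_group
    (Perm (Fin n)) {M : FASData n // IsFAS M}
  have hquot : uCount n = Fintype.card
      (Quotient (MulAction.orbitRel (Perm (Fin n)) {M : FASData n // IsFAS M})) := by
    rw [← Nat.card_eq_fintype_card]
    refine Nat.card_congr (Quot.congrRight fun M N => ?_)
    rw [(MulAction.orbitRel (Perm (Fin n)) {M : FASData n // IsFAS M}).comm']
    exact exists_congr fun g => (isoVia_iff_transport_eq g M.1 N.1).trans
      (Subtype.ext_iff (a1 := g • M) (a2 := N)).symm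
  rw [Fintype.card_perm, Fintype.card_fin, ← hquot] at burnside
  rw [← burnside]
  refine Finset.sum_congr rfl fun g _ => ?_
  rw [← Nat.card_eq_fintype_card]
  refine Nat.card_congr ((Equiv.subtypeEquivRight fun M => ?_).trans
    (Equiv.subtypeSubtypeEquivSubtypeInter IsFAS fun M => IsoVia g M M))
  rw [isoVia_iff_transport_eq]
  exact Subtype.ext_iff

theorem card_isoVia_eq_sum {n : ℕ} (g : Perm (Fin n)) :
    Nat.card {M : FASData n // IsFAS M ∧ IsoVia g M M} = ∑ f : Fin n → Fin n,
      ∑ I : Finset (Fin n), Nat.card {T // IsFAS (f, I, T) ∧ IsoVia g (f, I, T) (f, I, T)} := by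
  rw [Nat.card_congr (Equiv.subtypeProdEquivSigmaSubtype
    fun f p => IsFAS (f, p) ∧ IsoVia g (f, p) (f, p)), Nat.card_sigma]
  refine Finset.sum_congr rfl fun f _ => ?_
  rw [Nat.card_congr (Equiv.subtypeProdEquivSigmaSubtype
    fun I T => IsFAS (f, I, T) ∧ IsoVia g (f, I, T) (f, I, T)), Nat.card_sigma]

theorem le_uCount_mul_factorial (n : ℕ) : n * 2 ^ Q n n ≤ uCount n * n.factorial := by
  classical
  rw [uCount_mul_factorial]
  have hone : ∀ M : FASData n, IsoVia 1 M M :=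
    fun _ => ⟨fun _ => rfl, fun _ => Iff.rfl, fun _ _ _ => Iff.rfl⟩
  refine le_trans ?_ (Finset.single_le_sum (fun _ _ => Nat.zero_le _)
    (Finset.mem_univ (1 : Perm (Fin n))))
  rw [card_isoVia_eq_sum]
  refine le_trans ?_ (Finset.single_le_sum (fun _ _ => Nat.zero_le _)
    (Finset.mem_univ (id : Fin n → Fin n)))
  simp only [hone, and_true]
  calc n * 2 ^ Q n n = ∑ _e : Fin n, 2 ^ Q n n := by simp
    _ ≤ ∑ e : Fin n, Nat.card {T // IsFAS ((id : Fin n → Fin n), {e}, T)} :=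
        Finset.sum_le_sum fun e _ => two_pow_Q_le_card e
    _ = ∑ I ∈ Finset.univ.image (fun e : Fin n => ({e} : Finset (Fin n))),
          Nat.card {T // IsFAS ((id : Fin n → Fin n), I, T)} := by
        rw [Finset.sum_image fun _ _ _ _ h => Finset.singleton_injective h]
    _ ≤ _ := Finset.sum_le_sum_of_subset (Finset.subset_univ _)

theorem sum_pow_card_moved_le (n : ℕ) {q : ℝ} (hq : 0 ≤ q) :
    ∑ f : Fin n → Fin n, q ^ Fintype.card {x // f x ≠ x} ≤ (1 + n * q) ^ n := by
  have hprod : ∀ f : Fin n → Fin n, q ^ Fintype.card {x // f x ≠ x} =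
      ∏ x, if f x = x then 1 else q := by
    intro f
    rw [Finset.prod_ite, Finset.prod_const_one, one_mul, Finset.prod_const, Fintype.card_subtype]
  simp only [hprod]
  have hswap := Finset.prod_univ_sum (fun _ : Fin n => (Finset.univ : Finset (Fin n)))
    (fun x y => if y = x then (1 : ℝ) else q)
  rw [Fintype.piFinset_univ] at hswap
  rw [← hswap]
  calc ∏ x : Fin n, ∑ y : Fin n, (if y = x then (1 : ℝ) else q)
      ≤ ∏ _x : Fin n, (1 + n * q) := by
        refine Finset.prod_le_prod (fun x _ => Finset.sum_nonneg fun y _ => ?_) fun x _ => ?_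
        · split_ifs <;> positivity
        · calc ∑ y : Fin n, (if y = x then (1 : ℝ) else q)
              ≤ ∑ y : Fin n, ((if y = x then (1 : ℝ) else 0) + q) := by
                refine Finset.sum_le_sum fun y _ => ?_
                split_ifs <;> linarith
            _ = 1 + n * q := by simp [Finset.sum_add_distrib]
    _ = (1 + n * q) ^ n := by simp

theorem card_T_isoVia_le {n D : ℕ} (hn : 12 ≤ n) (hD : 6 * D + 3 * n ≤ n ^ 2)
    (hD' : 12 * D + 5 * n ≤ (n - 1) ^ 2) (g : Perm (Fin n)) (f : Fin n → Fin n)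
    (I : Finset (Fin n)) :
    (Nat.card {T // IsFAS (f, I, T) ∧ IsoVia g (f, I, T) (f, I, T)} : ℝ) ≤ 2 ^ Q n n *
      ((if g = 1 then 1 else 0) * ((if I.card = 1 then 1 else 0) *
        ((1 / 2) ^ ((n - 1) / 2)) ^ Fintype.card {x // f x ≠ x}) + (1 / 2) ^ D) := by
  have hmono : Nat.card {T // IsFAS (f, I, T) ∧ IsoVia g (f, I, T) (f, I, T)} ≤
      Nat.card {T // IsFAS (f, I, T)} :=
    Nat.card_le_card_of_injective (fun T => ⟨T.1, T.2.1⟩) fun T T' h =>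
      Subtype.ext (Subtype.ext_iff.1 h :)
  have hreal : ∀ c k : ℕ, c * 2 ^ k ≤ 2 ^ Q n n → (c : ℝ) ≤ 2 ^ Q n n * (1 / 2) ^ k := by
    intro c k h
    rw [one_div, inv_pow, ← div_eq_mul_inv, le_div_iff₀ (by positivity)]
    exact_mod_cast h
  rcases lt_trichotomy I.card 1 with hI | hI | hI
  · have hI' : I = ∅ := Finset.card_eq_zero.1 (by omega)
    have : IsEmpty {T // IsFAS (f, I, T) ∧ IsoVia g (f, I, T) (f, I, T)} := by
      refine ⟨fun T => ?_⟩
      obtain ⟨i, hi, -⟩ := (T.2.1.2 ⟨0, by omega⟩ ⟨0, by omega⟩).1 rfl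
      simp [hI'] at hi
    rw [Nat.card_of_isEmpty, Nat.cast_zero]
    positivity
  · obtain ⟨e, rfl⟩ := Finset.card_eq_one.1 hI
    by_cases hg : g = 1
    · have h := hreal _ _ ((Nat.mul_le_mul_right _ hmono).trans
        (card_mul_two_pow_le_of_singleton f e))
      rw [mul_comm (Fintype.card _), pow_mul] at h
      refine h.trans (mul_le_mul_of_nonneg_left ?_ (by positivity))
      rw [if_pos hg, if_pos hI, one_mul, one_mul]
      exact le_add_of_nonneg_right (by positivity)
    · refine (hreal _ _ (card_automorphic_mul_two_pow_le f e hg hD')).trans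
        (mul_le_mul_of_nonneg_left ?_ (by positivity))
      exact le_add_of_nonneg_left (by positivity)
  · refine (hreal _ _ ((Nat.mul_le_mul_right _ hmono).trans
      (card_mul_two_pow_le_of_two_le hn f I hI hD))).trans
        (mul_le_mul_of_nonneg_left ?_ (by positivity))
    exact le_add_of_nonneg_left (by positivity)

theorem uCount_mul_factorial_le {n D : ℕ} (hn : 12 ≤ n) (hD : 6 * D + 3 * n ≤ n ^ 2)
    (hD' : 12 * D + 5 * n ≤ (n - 1) ^ 2) :
    (uCount n * n.factorial : ℝ) ≤ 2 ^ Q n n *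
      (n * (1 + n * (1 / 2) ^ ((n - 1) / 2)) ^ n + n.factorial * (n ^ n * (2 ^ n * (1 / 2) ^ D))) := by
  have h := uCount_mul_factorial n
  simp only [card_isoVia_eq_sum] at h
  have h' : (uCount n * n.factorial : ℝ) = ∑ g : Perm (Fin n), ∑ f : Fin n → Fin n,
      ∑ I : Finset (Fin n),
        (Nat.card {T // IsFAS (f, I, T) ∧ IsoVia g (f, I, T) (f, I, T)} : ℝ) := by
    exact_mod_cast h
  rw [h']
  refine (Finset.sum_le_sum fun g _ => Finset.sum_le_sum fun f _ => Finset.sum_le_sum fun I _ =>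
    card_T_isoVia_le hn hD hD' g f I).trans ?_
  have hI : ∑ I : Finset (Fin n), (if I.card = 1 then (1 : ℝ) else 0) = n := by
    rw [Finset.sum_boole, Finset.univ_filter_card_eq, Finset.card_powersetCard]
    simp
  have hq := sum_pow_card_moved_le n (q := (1 / 2) ^ ((n - 1) / 2)) (by positivity)
  simp only [← Finset.mul_sum, Finset.sum_add_distrib, ← Finset.sum_mul, hI]
  simp only [Finset.sum_const, Finset.card_univ, Fintype.card_perm, Fintype.card_fin,
    Fintype.card_finset, Fintype.card_fun, nsmul_eq_mul, Nat.cast_pow, Nat.cast_ofNat,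
    Finset.sum_ite_eq', Finset.mem_univ, if_true, one_mul]
  gcongr

theorem tendsto_sq_mul_half_pow_div {k : ℕ} (hk : 0 < k) (C : ℝ) :
    Tendsto (fun n : ℕ => C * (n : ℝ) ^ 2 * (1 / 2) ^ (n / k)) atTop (𝓝 0) := by
  have hpoly : Tendsto (fun m : ℕ => (m : ℝ) ^ 2 * (1 / 2) ^ m) atTop (𝓝 0) :=
    tendsto_pow_const_mul_const_pow_of_lt_one 2 (by norm_num) (by norm_num)
  have hshift := (hpoly.comp (tendsto_add_atTop_nat 1)).const_mul (2 * |C| * (k : ℝ) ^ 2)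
  rw [mul_zero] at hshift
  have hdiv : Tendsto (fun n : ℕ => n / k) atTop atTop :=
    Nat.tendsto_div_const_atTop hk.ne'
  refine squeeze_zero_norm (fun n => ?_) (hshift.comp hdiv)
  have hn : (n : ℝ) ≤ k * ((n / k : ℕ) + 1) := by
    have : n ≤ k * (n / k + 1) := (Nat.lt_mul_div_succ n hk).le
    exact_mod_cast this
  have hsq : (n : ℝ) ^ 2 ≤ (k * ((n / k : ℕ) + 1)) ^ 2 := by gcongr
  simp only [Function.comp_apply, norm_mul, norm_pow, Real.norm_eq_abs]
  rw [abs_of_nonneg (by positivity : (0 : ℝ) ≤ n), abs_of_nonneg (by norm_num : (0 : ℝ) ≤ 1 / 2)]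
  calc |C| * (n : ℝ) ^ 2 * (1 / 2) ^ (n / k)
      ≤ |C| * (k * ((n / k : ℕ) + 1)) ^ 2 * (1 / 2) ^ (n / k) := by gcongr
    _ = 2 * |C| * (k : ℝ) ^ 2 * (((n / k + 1 : ℕ) : ℝ) ^ 2 * (1 / 2) ^ (n / k + 1)) := by
      push_cast; ring

theorem tendsto_main_term :
    Tendsto (fun n : ℕ => (1 + (n : ℝ) * (1 / 2) ^ ((n - 1) / 2)) ^ n) atTop (𝓝 1) := by
  have hexp : Tendsto (fun n : ℕ => Real.exp (2 * (n : ℝ) ^ 2 * (1 / 2) ^ (n / 2))) atTop (𝓝 1) := by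
    have := (Real.continuous_exp.tendsto 0).comp (tendsto_sq_mul_half_pow_div two_pos 2)
    rwa [Real.exp_zero] at this
  refine tendsto_of_tendsto_of_tendsto_of_le_of_le tendsto_const_nhds hexp (fun n => ?_) fun n => ?_
  · exact one_le_pow₀ (le_add_of_nonneg_right (by positivity))
  · have hhalf : (1 / 2 : ℝ) ^ ((n - 1) / 2) ≤ 2 * (1 / 2) ^ (n / 2) := by
      calc (1 / 2 : ℝ) ^ ((n - 1) / 2) = 2 * (1 / 2) ^ ((n - 1) / 2 + 1) := by ring
        _ ≤ 2 * (1 / 2) ^ (n / 2) := by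
          refine mul_le_mul_of_nonneg_left ?_ two_pos.le
          exact pow_le_pow_of_le_one (by norm_num) (by norm_num) (by omega)
    calc (1 + (n : ℝ) * (1 / 2) ^ ((n - 1) / 2)) ^ n
        ≤ Real.exp (n * (1 / 2) ^ ((n - 1) / 2)) ^ n := by
          gcongr
          rw [add_comm]
          exact Real.add_one_le_exp _
      _ = Real.exp (n * (n * (1 / 2) ^ ((n - 1) / 2))) := (Real.exp_nat_mul _ n).symm
      _ ≤ Real.exp (n * (n * (2 * (1 / 2) ^ (n / 2)))) := by gcongr
      _ = Real.exp (2 * (n : ℝ) ^ 2 * (1 / 2) ^ (n / 2)) := by ring_nf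

theorem tendsto_error_term :
    Tendsto (fun n : ℕ => (n.factorial : ℝ) * (n ^ n * (2 ^ n * (1 / 2) ^ (n * (n / 24)))))
      atTop (𝓝 0) := by
  have hbase := tendsto_sq_mul_half_pow_div (k := 24) (by norm_num) 2
  refine tendsto_of_tendsto_of_tendsto_of_le_of_le' tendsto_const_nhds hbase
    (Eventually.of_forall fun n => by positivity) ?_
  filter_upwards [hbase.eventually_le_const one_pos, eventually_ge_atTop 1] with n hle hn
  calc (n.factorial : ℝ) * (n ^ n * (2 ^ n * (1 / 2) ^ (n * (n / 24))))
      ≤ (n : ℝ) ^ n * (n ^ n * (2 ^ n * (1 / 2) ^ (n * (n / 24)))) := by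
        gcongr
        exact_mod_cast Nat.factorial_le_pow n
    _ = (2 * (n : ℝ) ^ 2 * (1 / 2) ^ (n / 24)) ^ n := by
        rw [mul_comm n (n / 24), pow_mul]
        simp only [mul_pow]
        ring
    _ ≤ 2 * (n : ℝ) ^ 2 * (1 / 2) ^ (n / 24) :=
        pow_le_of_le_one (by positivity) hle (by omega)

/-- `2^{Q(n,n)}/(n-1)!` is an asymptotic formula for the number of `n`-atom
nonassociative relation algebras. -/
theorem stmt3 :
    Tendsto (fun n : ℕ =>
      (uCount n : ℝ) * (Nat.factorial (n - 1) : ℝ) / (2 : ℝ) ^ Q n n)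
      atTop (𝓝 1) := by
  have hupper := tendsto_main_term.add tendsto_error_term
  rw [add_zero] at hupper
  refine tendsto_of_tendsto_of_tendsto_of_le_of_le' tendsto_const_nhds hupper ?_ ?_
  · filter_upwards [eventually_ge_atTop 1] with n hn
    have h : (n * 2 ^ Q n n : ℝ) ≤ uCount n * n.factorial := by
      exact_mod_cast le_uCount_mul_factorial n
    have hfac : (n.factorial : ℝ) = n * (n - 1).factorial := by
      exact_mod_cast (Nat.mul_factorial_pred (by omega)).symm
    have hn' : (0 : ℝ) < n := by exact_mod_cast hn
    rw [hfac] at h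
    rw [one_le_div (by positivity)]
    refine le_of_mul_le_mul_left ?_ hn'
    linarith
  · filter_upwards [eventually_ge_atTop 24] with n hn
    have hdiv : 24 * (n * (n / 24)) ≤ n ^ 2 := by
      calc 24 * (n * (n / 24)) = n * (24 * (n / 24)) := by ring
        _ ≤ n * n := Nat.mul_le_mul_left _ (Nat.mul_div_le n 24)
        _ = n ^ 2 := (sq n).symm
    have hn2 : 24 * n ≤ n ^ 2 := by nlinarith
    have hpred : n ^ 2 ≤ (n - 1) ^ 2 + 2 * n := by
      obtain ⟨v, rfl⟩ : ∃ v, n = v + 1 := ⟨n - 1, by omega⟩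
      rw [Nat.add_sub_cancel]
      nlinarith
    have h := uCount_mul_factorial_le (n := n) (D := n * (n / 24)) (by omega) (by omega) (by omega)
    have hfac : (n.factorial : ℝ) = n * (n - 1).factorial := by
      exact_mod_cast (Nat.mul_factorial_pred (by omega)).symm
    have hn' : (1 : ℝ) ≤ n := by exact_mod_cast (by omega : 1 ≤ n)
    rw [div_le_iff₀ (by positivity)]
    refine le_of_mul_le_mul_left ?_ (zero_lt_one.trans_le hn')
    set A : ℝ := (1 + (n : ℝ) * (1 / 2) ^ ((n - 1) / 2)) ^ n
    set B : ℝ := (n.factorial : ℝ) * (n ^ n * (2 ^ n * (1 / 2) ^ (n * (n / 24)))) with hB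
    have hB0 : 0 ≤ B := by positivity
    calc (n : ℝ) * (uCount n * (n - 1).factorial) = uCount n * n.factorial := by
          rw [hfac]; ring
      _ ≤ 2 ^ Q n n * (n * A + B) := h
      _ ≤ 2 ^ Q n n * (n * A + n * B) := by
          gcongr
          exact le_mul_of_one_le_left hB0 hn'
      _ = n * ((A + B) * 2 ^ Q n n) := by ring
end

section
/- The class FSIAS_e has the amalgamation property: for all FSIAS_e structures S, V, W and all embeddings μ : S → V and ν : S → W, there exist an FSIAS_e structure D and embeddings μ′ : V → D and ν′ : W → D such that μ′ ∘ μ = ν′ ∘ ν. -/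
/-- A finite symmetric integral atom structure in the signature `{f, e, T}`:
a finite set with `f = id`, a constant `e`, and a ternary relation `T`
satisfying (IP) and (II). -/
structure FSIASe where
  carrier : Type
  fin : Finite carrier
  f : carrier → carrier
  e : carrier
  T : Set (carrier × carrier × carrier)
  symm : ∀ x, f x = x
  ip : ∀ a b c, (a, b, c) ∈ T → (f a, c, b) ∈ T ∧ (c, f b, a) ∈ T
  ii : ∀ a b, a = b ↔ (a, e, b) ∈ T

/-- An embedding of structures in the signature `{f, e, T}`: an injective map
preserving `f` and `e`, and preserving `T` in both directions. -/
structure FSIASeEmb (A B : FSIASe) where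
  toFun : A.carrier → B.carrier
  inj : Function.Injective toFun
  map_f : ∀ x, toFun (A.f x) = B.f (toFun x)
  map_e : toFun A.e = B.e
  map_T : ∀ a b c, (a, b, c) ∈ A.T ↔ (toFun a, toFun b, toFun c) ∈ B.T

/-- Disjoint amalgamation of finite types along a pair of injections. -/
theorem exists_disjoint_amalgam {S V W : Type} [Finite V] [Finite W] {m : S → V} {n : S → W}
    (hm : Function.Injective m) (hn : Function.Injective n) :
    ∃ (D : Type) (_ : Finite D) (i : V → D) (j : W → D),
      Function.Injective i ∧ Function.Injective j ∧ (∀ s, i (m s) = j (n s)) ∧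
      (∀ d, (∃ v, i v = d) ∨ ∃ w, j w = d) ∧
      ∀ v w, i v = j w → ∃ s, m s = v ∧ n s = w := by
  classical
  let j : W → V ⊕ {w : W // ¬ ∃ s, n s = w} := fun w =>
    if h : ∃ s, n s = w then Sum.inl (m h.choose) else Sum.inr ⟨w, h⟩
  have j_base : ∀ s, j (n s) = Sum.inl (m s) := fun s => by
    have h : ∃ t, n t = n s := ⟨s, rfl⟩
    simp only [j, dif_pos h, hn h.choose_spec]
  have j_new : ∀ w (h : ¬ ∃ s, n s = w), j w = Sum.inr ⟨w, h⟩ := fun w h => by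
    simp only [j, dif_neg h]
  refine ⟨_, inferInstance, Sum.inl, j, Sum.inl_injective, ?_, fun s => (j_base s).symm, ?_, ?_⟩
  · intro w w' h
    by_cases hw : ∃ s, n s = w <;> by_cases hw' : ∃ s, n s = w'
    · obtain ⟨s, rfl⟩ := hw
      obtain ⟨t, rfl⟩ := hw'
      rw [j_base, j_base] at h
      rw [hm (Sum.inl_injective h)]
    · obtain ⟨s, rfl⟩ := hw
      rw [j_base, j_new _ hw'] at h
      cases h
    · obtain ⟨t, rfl⟩ := hw'
      rw [j_base, j_new _ hw] at h
      cases h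
    · rw [j_new _ hw, j_new _ hw'] at h
      exact congrArg Subtype.val (Sum.inr_injective h)
  · rintro (v | ⟨w, hw⟩)
    · exact Or.inl ⟨v, rfl⟩
    · exact Or.inr ⟨w, j_new w hw⟩
  · intro v w h
    by_cases hw : ∃ s, n s = w
    · obtain ⟨s, rfl⟩ := hw
      rw [j_base] at h
      exact ⟨s, (Sum.inl_injective h).symm, rfl⟩
    · rw [j_new _ hw] at h
      cases h

namespace FSIASe

theorem T_swap_right (A : FSIASe) {a b c : A.carrier} (h : (a, b, c) ∈ A.T) : (a, c, b) ∈ A.T := by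
  simpa only [A.symm] using (A.ip a b c h).1

theorem T_swap_outer (A : FSIASe) {a b c : A.carrier} (h : (a, b, c) ∈ A.T) : (c, b, a) ∈ A.T := by
  simpa only [A.symm] using (A.ip a b c h).2

end FSIASe

/-- The class `FSIAS_e` has the amalgamation property. -/
theorem stmt4 (S V W : FSIASe) (μ : FSIASeEmb S V) (ν : FSIASeEmb S W) :
    ∃ (D : FSIASe) (μ' : FSIASeEmb V D) (ν' : FSIASeEmb W D),
      ∀ x, μ'.toFun (μ.toFun x) = ν'.toFun (ν.toFun x) := by
  have := V.fin
  have := W.fin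
  obtain ⟨D, hD, i, j, hi, hj, hij, hsurj, hdisj⟩ := exists_disjoint_amalgam μ.inj ν.inj
  have he : i V.e = j W.e := by rw [← μ.map_e, ← ν.map_e, hij]
  let T : Set (D × D × D) := {t |
    (∃ a b c, (a, b, c) ∈ V.T ∧ t = (i a, i b, i c)) ∨
    ∃ a b c, (a, b, c) ∈ W.T ∧ t = (j a, j b, j c)}
  refine ⟨⟨D, hD, id, i V.e, T, fun _ => rfl, ?_, ?_⟩, ⟨i, hi, ?_, rfl, ?_⟩,
    ⟨j, hj, ?_, he.symm, ?_⟩, hij⟩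
  · rintro _ _ _ (⟨a, b, c, h, ⟨⟩⟩ | ⟨a, b, c, h, ⟨⟩⟩)
    · exact ⟨Or.inl ⟨a, c, b, V.T_swap_right h, rfl⟩, Or.inl ⟨c, b, a, V.T_swap_outer h, rfl⟩⟩
    · exact ⟨Or.inr ⟨a, c, b, W.T_swap_right h, rfl⟩, Or.inr ⟨c, b, a, W.T_swap_outer h, rfl⟩⟩
  · intro x y
    constructor
    · rintro rfl
      obtain ⟨v, rfl⟩ | ⟨w, rfl⟩ := hsurj x
      · exact Or.inl ⟨v, V.e, v, (V.ii v v).1 rfl, rfl⟩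
      · exact Or.inr ⟨w, W.e, w, (W.ii w w).1 rfl, by rw [he]⟩
    · rintro (⟨a, b, c, h, heq⟩ | ⟨a, b, c, h, heq⟩) <;> simp only [Prod.mk.injEq] at heq <;>
        obtain ⟨rfl, hb, rfl⟩ := heq
      · obtain rfl := hi hb
        rw [(V.ii a c).2 h]
      · obtain rfl := hj (he.symm.trans hb)
        rw [(W.ii a c).2 h]
  · exact fun x => congrArg i (V.symm x)
  · intro a b c
    refine ⟨fun h => Or.inl ⟨a, b, c, h, rfl⟩, ?_⟩
    rintro (⟨a', b', c', h, heq⟩ | ⟨a', b', c', h, heq⟩) <;> simp only [Prod.mk.injEq] at heq <;>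
      obtain ⟨ha, hb, hc⟩ := heq
    · rwa [hi ha, hi hb, hi hc]
    · obtain ⟨s, rfl, rfl⟩ := hdisj _ _ ha
      obtain ⟨t, rfl, rfl⟩ := hdisj _ _ hb
      obtain ⟨u, rfl, rfl⟩ := hdisj _ _ hc
      exact (μ.map_T s t u).1 ((ν.map_T s t u).2 h)
  · exact fun x => congrArg j (W.symm x)
  · intro a b c
    refine ⟨fun h => Or.inr ⟨a, b, c, h, rfl⟩, ?_⟩
    rintro (⟨a', b', c', h, heq⟩ | ⟨a', b', c', h, heq⟩) <;> simp only [Prod.mk.injEq] at heq <;>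
      obtain ⟨ha, hb, hc⟩ := heq
    · obtain ⟨s, rfl, rfl⟩ := hdisj _ _ ha.symm
      obtain ⟨t, rfl, rfl⟩ := hdisj _ _ hb.symm
      obtain ⟨u, rfl, rfl⟩ := hdisj _ _ hc.symm
      exact (ν.map_T s t u).1 ((μ.map_T s t u).2 h)
    · rwa [hj ha, hj hb, hj hc]
end

section
/- There exists a countable structure F in the signature with one unary function symbol f, one constant symbol e, and one ternary relation symbol T, such that F is ultrahomogeneous (every isomorphism between finitely generated substructures of F extends to an automorphism of F) and the age of F (the class of all finitely generated structures that embed into F) is, up to isomorphism, exactly the class FSIAS_e. -/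
/-- A structure in the signature with one unary function symbol `f`, one constant
symbol `e`, and one ternary relation symbol `T`. -/
structure SigStr where
  carrier : Type
  f : carrier → carrier
  e : carrier
  T : Set (carrier × carrier × carrier)

/-- An embedding: an injective map preserving `f` and `e`, and preserving `T`
in both directions. -/
structure SigEmb (A B : SigStr) where
  toFun : A.carrier → B.carrier
  inj : Function.Injective toFun
  map_f : ∀ x, toFun (A.f x) = B.f (toFun x)
  map_e : toFun A.e = B.e
  map_T : ∀ a b c, (a, b, c) ∈ A.T ↔ (toFun a, toFun b, toFun c) ∈ B.T

/-- An isomorphism: a bijection preserving `f`, `e`, and `T` in both directions. -/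
structure SigIso (A B : SigStr) where
  toEquiv : A.carrier ≃ B.carrier
  map_f : ∀ x, toEquiv (A.f x) = B.f (toEquiv x)
  map_e : toEquiv A.e = B.e
  map_T : ∀ a b c, (a, b, c) ∈ A.T ↔ (toEquiv a, toEquiv b, toEquiv c) ∈ B.T

/-- A subset is (the universe of) a substructure iff it contains `e` and is
closed under `f`. -/
def SigStr.Closed (A : SigStr) (s : Set A.carrier) : Prop :=
  A.e ∈ s ∧ ∀ x ∈ s, A.f x ∈ s

/-- The substructure induced on a closed subset. -/
def SigStr.sub (A : SigStr) (s : Set A.carrier) (h : A.Closed s) : SigStr where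
  carrier := s
  f := fun x => ⟨A.f x, h.2 x x.2⟩
  e := ⟨A.e, h.1⟩
  T := {p | ((p.1 : A.carrier), (p.2.1 : A.carrier), (p.2.2 : A.carrier)) ∈ A.T}

/-- A closed subset is finitely generated iff it is the least closed set
containing some finite subset. -/
def SigStr.FG (A : SigStr) (s : Set A.carrier) : Prop :=
  A.Closed s ∧ ∃ t : Set A.carrier, t.Finite ∧ s = ⋂₀ {u | A.Closed u ∧ t ⊆ u}

/-- A structure is ultrahomogeneous iff every isomorphism between finitely
generated substructures extends to an automorphism. -/
def SigStr.Ultrahomogeneous (F : SigStr) : Prop :=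
  ∀ (s t : Set F.carrier) (hs : F.FG s) (ht : F.FG t)
    (φ : SigIso (F.sub s hs.1) (F.sub t ht.1)),
    ∃ σ : SigIso F F, ∀ x : s, σ.toEquiv x.1 = (φ.toEquiv x).1

/-- Membership in the class `FSIAS_e`: finite, symmetric, and satisfying
(IP) and (II). -/
def SigStr.IsFSIASe (A : SigStr) : Prop :=
  Finite A.carrier ∧ (∀ x, A.f x = x) ∧
  (∀ a b c, (a, b, c) ∈ A.T → (A.f a, c, b) ∈ A.T ∧ (c, A.f b, a) ∈ A.T) ∧
  (∀ a b, a = b ↔ (a, A.e, b) ∈ A.T)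

/-- `A` belongs to the age of `F`: `A` is finitely generated (generated by the
whole of its finite generating data) and embeds into `F`. -/
def SigStr.InAge (A F : SigStr) : Prop :=
  A.FG Set.univ ∧ Nonempty (SigEmb A F)

namespace SigStr

/-- The universal part of `FSIAS_e`: all of its axioms except finiteness. -/
structure IsSIASe (A : SigStr) : Prop where
  f_eq : ∀ x, A.f x = x
  swap_right : ∀ {a b c}, (a, b, c) ∈ A.T → (a, c, b) ∈ A.T
  reverse : ∀ {a b c}, (a, b, c) ∈ A.T → (c, b, a) ∈ A.T
  eq_iff : ∀ a b, a = b ↔ (a, A.e, b) ∈ A.T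

theorem isFSIASe_iff {A : SigStr} : A.IsFSIASe ↔ Finite A.carrier ∧ A.IsSIASe := by
  constructor
  · rintro ⟨hfin, hf, hT, he⟩
    simp only [hf] at hT
    exact ⟨hfin, hf, fun h => (hT _ _ _ h).1, fun h => (hT _ _ _ h).2, he⟩
  · rintro ⟨hfin, h⟩
    refine ⟨hfin, h.f_eq, fun a b c hT => ?_, h.eq_iff⟩
    simp only [h.f_eq]
    exact ⟨h.swap_right hT, h.reverse hT⟩

theorem IsSIASe.swap_right_iff {A : SigStr} (h : A.IsSIASe) {a b c : A.carrier} :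
    (a, b, c) ∈ A.T ↔ (a, c, b) ∈ A.T :=
  ⟨h.swap_right, h.swap_right⟩

theorem IsSIASe.reverse_iff {A : SigStr} (h : A.IsSIASe) {a b c : A.carrier} :
    (a, b, c) ∈ A.T ↔ (c, b, a) ∈ A.T :=
  ⟨h.reverse, h.reverse⟩

theorem IsSIASe.swap_left_iff {A : SigStr} (h : A.IsSIASe) {a b c : A.carrier} :
    (a, b, c) ∈ A.T ↔ (b, a, c) ∈ A.T := by
  rw [h.swap_right_iff, h.reverse_iff, h.swap_right_iff]

theorem IsSIASe.of_emb {A F : SigStr} (h : F.IsSIASe) (i : SigEmb A F) : A.IsSIASe where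
  f_eq x := i.inj (by rw [i.map_f, h.f_eq])
  swap_right hT := (i.map_T _ _ _).2 (h.swap_right ((i.map_T _ _ _).1 hT))
  reverse hT := (i.map_T _ _ _).2 (h.reverse ((i.map_T _ _ _).1 hT))
  eq_iff a b := by rw [i.map_T, i.map_e, ← h.eq_iff, i.inj.eq_iff]

theorem IsSIASe.finite_of_fg {A : SigStr} (h : A.IsSIASe) {s : Set A.carrier} (hs : A.FG s) :
    s.Finite := by
  obtain ⟨-, t, ht, rfl⟩ := hs
  refine (ht.insert A.e).subset (Set.sInter_subset_of_mem ⟨⟨?_, ?_⟩, Set.subset_insert _ _⟩)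
  · exact Set.mem_insert _ _
  · intro x hx
    rwa [h.f_eq]

theorem fg_univ_of_finite (A : SigStr) [Finite A.carrier] : A.FG Set.univ := by
  refine ⟨⟨trivial, fun _ _ => trivial⟩, Set.univ, Set.finite_univ, ?_⟩
  symm
  rw [Set.sInter_eq_univ]
  exact fun u hu => Set.univ_subset_iff.1 hu.2

/-- A finite set of pairs which is the graph of an isomorphism between relational substructures
of `A` and `B` containing the constants. -/
structure IsPartialIso (A B : SigStr) (p : Finset (A.carrier × B.carrier)) : Prop where
  e_mem : (A.e, B.e) ∈ p
  eq_iff : ∀ q ∈ p, ∀ r ∈ p, q.1 = r.1 ↔ q.2 = r.2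
  T_iff : ∀ q ∈ p, ∀ r ∈ p, ∀ t ∈ p, (q.1, r.1, t.1) ∈ A.T ↔ (q.2, r.2, t.2) ∈ B.T

theorem IsPartialIso.swap {A B : SigStr} {p : Finset (A.carrier × B.carrier)}
    (hp : IsPartialIso A B p) : IsPartialIso B A (p.map (Equiv.prodComm _ _).toEmbedding) := by
  refine ⟨by simpa using hp.e_mem, ?_, ?_⟩
  · simp only [Finset.mem_map_equiv]
    exact fun q hq r hr => (hp.eq_iff _ hq _ hr).symm
  · simp only [Finset.mem_map_equiv]
    exact fun q hq r hr t ht => (hp.T_iff _ hq _ hr _ ht).symm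

theorem isPartialIso_singleton {A B : SigStr} (hA : A.IsSIASe) (hB : B.IsSIASe) :
    IsPartialIso A B {(A.e, B.e)} := by
  refine ⟨by simp, by simp, ?_⟩
  simp [← hA.eq_iff, ← hB.eq_iff]

/-- A partial isomorphism extends by a pair of new points whose relations to its domain and to its
range correspond. -/
theorem IsPartialIso.insert {A B : SigStr} [DecidableEq (A.carrier × B.carrier)]
    (hA : A.IsSIASe) (hB : B.IsSIASe)
    {p : Finset (A.carrier × B.carrier)} (hp : IsPartialIso A B p) {x : A.carrier} {y : B.carrier}
    (hx : ∀ q ∈ p, q.1 ≠ x) (hy : ∀ q ∈ p, q.2 ≠ y)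
    (h₁ : ∀ q ∈ p, ∀ r ∈ p, (x, q.1, r.1) ∈ A.T ↔ (y, q.2, r.2) ∈ B.T)
    (h₂ : ∀ q ∈ p, (x, x, q.1) ∈ A.T ↔ (y, y, q.2) ∈ B.T)
    (h₃ : (x, x, x) ∈ A.T ↔ (y, y, y) ∈ B.T) : IsPartialIso A B (insert (x, y) p) := by
  refine ⟨Finset.mem_insert_of_mem hp.e_mem, ?_, ?_⟩
  · simp only [Finset.mem_insert]
    rintro q (rfl | hq) r (rfl | hr)
    · simp
    · simp [(hx r hr).symm, (hy r hr).symm]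
    · simp [hx q hq, hy q hq]
    · exact hp.eq_iff q hq r hr
  · simp only [Finset.mem_insert]
    rintro q (rfl | hq) r (rfl | hr) t (rfl | ht)
    · exact h₃
    · exact h₂ t ht
    · rw [hA.swap_right_iff, hB.swap_right_iff]
      exact h₂ r hr
    · exact h₁ r hr t ht
    · rw [hA.reverse_iff, hB.reverse_iff]
      exact h₂ q hq
    · rw [hA.swap_left_iff, hB.swap_left_iff]
      exact h₁ q hq t ht
    · rw [hA.reverse_iff, hB.reverse_iff]
      exact h₁ r hr q hq
    · exact hp.T_iff q hq r hr t ht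

/-- Every finite partial isomorphism from `A` to `B` extends to any further point of `A`. -/
def ExtendsFrom (A B : SigStr) : Prop :=
  ∀ p, IsPartialIso A B p → ∀ x, ∃ p', IsPartialIso A B p' ∧ p ⊆ p' ∧ ∃ y, (x, y) ∈ p'

theorem ExtendsFrom.swap {A B : SigStr} (h : ExtendsFrom A B) {p : Finset (B.carrier × A.carrier)}
    (hp : IsPartialIso B A p) (x : A.carrier) :
    ∃ p', IsPartialIso B A p' ∧ p ⊆ p' ∧ ∃ y, (y, x) ∈ p' := by
  obtain ⟨p', hp', hsub, y, hy⟩ := h _ hp.swap x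
  refine ⟨_, hp'.swap, fun q hq => ?_, y, by simpa using hy⟩
  rw [Finset.mem_map_equiv]
  exact hsub (by simpa [Finset.mem_map_equiv] using hq)

theorem ExtendsFrom.nonempty_emb {A B : SigStr} (hA : A.IsSIASe) (hB : B.IsSIASe)
    [Finite A.carrier] (h : ExtendsFrom A B) : Nonempty (SigEmb A B) := by
  classical
  have key : ∀ s : Finset A.carrier, ∃ p, IsPartialIso A B p ∧ ∀ x ∈ s, ∃ y, (x, y) ∈ p := by
    intro s
    induction s using Finset.induction_on with
    | empty => exact ⟨_, isPartialIso_singleton hA hB, by simp⟩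
    | insert x s _ ih =>
      obtain ⟨p, hp, hs⟩ := ih
      obtain ⟨p', hp', hsub, hx⟩ := h p hp x
      refine ⟨p', hp', fun z hz => ?_⟩
      rcases Finset.mem_insert.1 hz with rfl | hz
      · exact hx
      · exact (hs z hz).imp fun _ hy => hsub hy
  have := Fintype.ofFinite A.carrier
  obtain ⟨p, hp, hdom⟩ := key Finset.univ
  choose i hi using fun x => hdom x (Finset.mem_univ x)
  refine ⟨⟨i, fun a b hab => (hp.eq_iff _ (hi a) _ (hi b)).2 hab, fun x => ?_,
    (hp.eq_iff _ (hi A.e) _ hp.e_mem).1 rfl, fun a b c => hp.T_iff _ (hi a) _ (hi b) _ (hi c)⟩⟩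
  rw [hA.f_eq, hB.f_eq]

/-- The back-and-forth argument. -/
theorem IsPartialIso.exists_iso {A B : SigStr} (hA : A.IsSIASe) (hB : B.IsSIASe)
    [Countable A.carrier] [Countable B.carrier] (hAB : ExtendsFrom A B) (hBA : ExtendsFrom B A)
    {p : Finset (A.carrier × B.carrier)} (hp : IsPartialIso A B p) :
    ∃ σ : SigIso A B, ∀ q ∈ p, σ.toEquiv q.1 = q.2 := by
  have := Encodable.ofCountable A.carrier
  have := Encodable.ofCountable B.carrier
  let D : A.carrier ⊕ B.carrier → Order.Cofinal {p // IsPartialIso A B p} := Sum.elim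
    (fun x => ⟨{p | ∃ y, (x, y) ∈ p.1}, fun p => by
      obtain ⟨p', hp', hsub, hx⟩ := hAB p.1 p.2 x
      exact ⟨⟨p', hp'⟩, hx, hsub⟩⟩)
    (fun y => ⟨{p | ∃ x, (x, y) ∈ p.1}, fun p => by
      obtain ⟨p', hp', hsub, hy⟩ := hBA.swap p.2 y
      exact ⟨⟨p', hp'⟩, hy, hsub⟩⟩)
  let I := Order.idealOfCofinals ⟨p, hp⟩ D
  let R : A.carrier × B.carrier → Prop := fun q => ∃ r ∈ I, q ∈ r.1
  have hpR : ∀ q ∈ p, R q := fun q hq => ⟨_, Order.mem_idealOfCofinals ⟨p, hp⟩ D, hq⟩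
  have hfst : ∀ x, ∃ y, R (x, y) := fun x => by
    obtain ⟨r, ⟨y, hy⟩, hr⟩ := Order.cofinal_meets_idealOfCofinals ⟨p, hp⟩ D (Sum.inl x)
    exact ⟨y, r, hr, hy⟩
  have hsnd : ∀ y, ∃ x, R (x, y) := fun y => by
    obtain ⟨r, ⟨x, hx⟩, hr⟩ := Order.cofinal_meets_idealOfCofinals ⟨p, hp⟩ D (Sum.inr y)
    exact ⟨x, r, hr, hx⟩
  have hTR : ∀ q r t, R q → R r → R t →
      ((q.1 = r.1 ↔ q.2 = r.2) ∧ ((q.1, r.1, t.1) ∈ A.T ↔ (q.2, r.2, t.2) ∈ B.T)) := by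
    rintro q r t ⟨u, hu, hqu⟩ ⟨v, hv, hrv⟩ ⟨w, hw, htw⟩
    obtain ⟨m, hm, hum, hvm⟩ := I.directed u hu v hv
    obtain ⟨n, -, hmn, hwn⟩ := I.directed m hm w hw
    have hq := hmn (hum hqu)
    have hr := hmn (hvm hrv)
    exact ⟨n.2.eq_iff _ hq _ hr, n.2.T_iff _ hq _ hr _ (hwn htw)⟩
  have heq : ∀ {q r}, R q → R r → (q.1 = r.1 ↔ q.2 = r.2) := fun hq hr => (hTR _ _ _ hq hr hr).1
  choose i hi using hfst
  choose j hj using hsnd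
  refine ⟨⟨⟨i, j, fun x => (heq (hj (i x)) (hi x)).2 rfl, fun y => (heq (hi (j y)) (hj y)).1 rfl⟩,
    fun x => ?_, (heq (hi A.e) (hpR _ hp.e_mem)).1 rfl,
    fun a b c => (hTR _ _ _ (hi a) (hi b) (hi c)).2⟩,
    fun q hq => (heq (hi q.1) (hpR q hq)).1 rfl⟩
  rw [hA.f_eq, hB.f_eq]

theorem IsSIASe.ultrahomogeneous {F : SigStr} (hF : F.IsSIASe) [Countable F.carrier]
    (h : ExtendsFrom F F) : F.Ultrahomogeneous := by
  classical
  intro s t hs ht φ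
  have := (hF.finite_of_fg hs).fintype
  have hp : IsPartialIso F F (Finset.univ.image fun x : s => (x.1, (φ.toEquiv x).1)) := by
    refine ⟨?_, ?_, ?_⟩
    · rw [Finset.mem_image]
      exact ⟨⟨F.e, hs.1.1⟩, Finset.mem_univ _, Prod.ext rfl (congrArg Subtype.val φ.map_e)⟩
    · simp only [Finset.forall_mem_image]
      intro x _ y _
      exact Subtype.ext_iff.symm.trans (φ.toEquiv.apply_eq_iff_eq.symm.trans Subtype.ext_iff)
    · simp only [Finset.forall_mem_image]
      exact fun x _ y _ z _ => φ.map_T x y z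
  obtain ⟨σ, hσ⟩ := hp.exists_iso hF hF h h
  exact ⟨σ, fun x => hσ _ (Finset.mem_image_of_mem _ (Finset.mem_univ x))⟩

/-- An enumeration of the finite sets of multisets of naturals in which every value recurs
infinitely often. -/
def code (n : ℕ) : Finset (Multiset ℕ) :=
  (Encodable.decode n.unpair.1).getD ∅

theorem exists_code_eq (D : Finset (Multiset ℕ)) (N : ℕ) : ∃ m, N ≤ m ∧ code m = D :=
  ⟨Nat.pair (Encodable.encode D) N, Nat.right_le_pair _ _, by simp [code]⟩

/-- A multiset of naturals is generic if `code` of its largest element lists the rest of it. -/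
def Generic (s : Multiset ℕ) : Prop :=
  s.filter (· ≠ s.sup) ∈ code s.sup

/-- The ternary relation of the Fraïssé limit: off the identity element `0` it consists of the
triples with generic underlying multiset. -/
def limitT : Set (ℕ × ℕ × ℕ) :=
  {q | (q.1 = 0 ∧ q.2.1 = q.2.2) ∨ (q.2.1 = 0 ∧ q.1 = q.2.2) ∨ (q.2.2 = 0 ∧ q.1 = q.2.1) ∨
    (q.1 ≠ 0 ∧ q.2.1 ≠ 0 ∧ q.2.2 ≠ 0 ∧ Generic {q.1, q.2.1, q.2.2})}

theorem mem_limitT {a b c : ℕ} : (a, b, c) ∈ limitT ↔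
    (a = 0 ∧ b = c) ∨ (b = 0 ∧ a = c) ∨ (c = 0 ∧ a = b) ∨
      (a ≠ 0 ∧ b ≠ 0 ∧ c ≠ 0 ∧ Generic {a, b, c}) :=
  Iff.rfl

theorem limitT_swap_right {a b c : ℕ} (h : (a, b, c) ∈ limitT) : (a, c, b) ∈ limitT := by
  have h' : ({a, c, b} : Multiset ℕ) = {a, b, c} := by
    simp only [Multiset.insert_eq_cons, ← Multiset.singleton_add, add_comm]
  rw [mem_limitT] at h ⊢
  grind

theorem limitT_reverse {a b c : ℕ} (h : (a, b, c) ∈ limitT) : (c, b, a) ∈ limitT := by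
  have h' : ({c, b, a} : Multiset ℕ) = {a, b, c} := by
    simp only [Multiset.insert_eq_cons, ← Multiset.singleton_add, add_comm, add_assoc]
  rw [mem_limitT] at h ⊢
  grind

theorem eq_iff_mem_limitT (a b : ℕ) : a = b ↔ (a, 0, b) ∈ limitT := by
  rw [mem_limitT]
  grind

theorem mem_limitT_of_lt {a b m : ℕ} (ha : a < m) (hb : b < m) (ha₀ : a ≠ 0) (hb₀ : b ≠ 0) :
    (m, a, b) ∈ limitT ↔ {a, b} ∈ code m := by
  have hsup : ({m, a, b} : Multiset ℕ).sup = m := by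
    simp [Multiset.insert_eq_cons, ha.le, hb.le]
  have hfil : ({m, a, b} : Multiset ℕ).filter (· ≠ m) = {a, b} := by
    simp [Multiset.insert_eq_cons, ha.ne, hb.ne, Multiset.filter_singleton]
  rw [mem_limitT, Generic, hsup, hfil]
  grind

theorem mem_limitT_self_of_lt {a m : ℕ} (ha : a < m) (ha₀ : a ≠ 0) :
    (m, m, a) ∈ limitT ↔ {a} ∈ code m := by
  have hsup : ({m, m, a} : Multiset ℕ).sup = m := by
    simp [Multiset.insert_eq_cons, ha.le]
  have hfil : ({m, m, a} : Multiset ℕ).filter (· ≠ m) = {a} := by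
    simp [Multiset.insert_eq_cons, ha.ne, Multiset.filter_singleton]
  rw [mem_limitT, Generic, hsup, hfil]
  grind

theorem mem_limitT_self {m : ℕ} (hm : m ≠ 0) : (m, m, m) ∈ limitT ↔ 0 ∈ code m := by
  have hsup : ({m, m, m} : Multiset ℕ).sup = m := by
    simp [Multiset.insert_eq_cons]
  have hfil : ({m, m, m} : Multiset ℕ).filter (· ≠ m) = 0 := by
    simp [Multiset.insert_eq_cons, Multiset.filter_singleton]
  rw [mem_limitT, Generic, hsup, hfil]
  grind

/-- The Fraïssé limit of `FSIAS_e`. -/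
def limit : SigStr where
  carrier := ℕ
  f := id
  e := 0
  T := limitT

theorem limit_isSIASe : limit.IsSIASe where
  f_eq _ := rfl
  swap_right := limitT_swap_right
  reverse := limitT_reverse
  eq_iff := eq_iff_mem_limitT

theorem multiset_pair_eq {α : Type*} {a b c d : α} (h : ({a, b} : Multiset α) = {c, d}) :
    (a = c ∧ b = d) ∨ (a = d ∧ b = c) := by
  simp only [Multiset.insert_eq_cons, Multiset.cons_eq_cons, Multiset.singleton_inj,
    Multiset.singleton_eq_cons_iff] at h
  grind

theorem extendsFrom_limit {A : SigStr} (hA : A.IsSIASe) : ExtendsFrom A limit := by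
  classical
  intro p hp x
  by_cases hx : ∃ q ∈ p, q.1 = x
  · obtain ⟨q, hq, rfl⟩ := hx
    exact ⟨p, hp, subset_rfl, q.2, hq⟩
  push Not at hx
  let val : A.carrier × limit.carrier → ℕ := Prod.snd
  let D : Finset (Multiset ℕ) :=
    ((p ×ˢ p).filter fun q => (x, q.1.1, q.2.1) ∈ A.T).image (fun q => {val q.1, val q.2}) ∪
    (p.filter fun q => (x, x, q.1) ∈ A.T).image (fun q => {val q}) ∪
    (if (x, x, x) ∈ A.T then {0} else ∅)
  have hinj : ∀ q ∈ p, ∀ r ∈ p, val q = val r → q.1 = r.1 := fun q hq r hr =>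
    (hp.eq_iff q hq r hr).2
  have hD₁ : ∀ q ∈ p, ∀ r ∈ p, {val q, val r} ∈ D ↔ (x, q.1, r.1) ∈ A.T := by
    intro q hq r hr
    constructor
    · intro h
      simp only [D, Finset.mem_union, Finset.mem_image, Finset.mem_filter, Finset.mem_product] at h
      rcases h with (⟨⟨u, v⟩, ⟨⟨hu, hv⟩, hT⟩, huv⟩ | ⟨u, -, hu⟩) | h
      · rcases multiset_pair_eq huv with ⟨h₁, h₂⟩ | ⟨h₁, h₂⟩
        · rwa [← hinj u hu q hq h₁, ← hinj v hv r hr h₂]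
        · rwa [hA.swap_right_iff, ← hinj u hu r hr h₁, ← hinj v hv q hq h₂]
      · simpa using congrArg Multiset.card hu
      · split_ifs at h <;> simp at h
    · intro hT
      refine Finset.mem_union_left _ (Finset.mem_union_left _ (Finset.mem_image.2 ⟨(q, r), ?_, rfl⟩))
      simp [hq, hr, hT]
  have hD₂ : ∀ q ∈ p, {val q} ∈ D ↔ (x, x, q.1) ∈ A.T := by
    intro q hq
    constructor
    · intro h
      simp only [D, Finset.mem_union, Finset.mem_image, Finset.mem_filter, Finset.mem_product] at h
      rcases h with (⟨⟨u, v⟩, -, huv⟩ | ⟨u, ⟨hu, hT⟩, huq⟩) | h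
      · simpa using congrArg Multiset.card huv
      · rwa [← hinj u hu q hq (Multiset.singleton_inj.1 huq)]
      · split_ifs at h <;> simp at h
    · intro hT
      refine Finset.mem_union_left _ (Finset.mem_union_right _ (Finset.mem_image.2 ⟨q, ?_, rfl⟩))
      simp [hq, hT]
  have hD₃ : 0 ∈ D ↔ (x, x, x) ∈ A.T := by
    by_cases h : (x, x, x) ∈ A.T <;> simp [D, h]
  obtain ⟨m, hm, hcode⟩ := exists_code_eq D (p.sup val + 1)
  have hlt : ∀ q ∈ p, val q < m := fun q hq => (Nat.lt_succ_of_le (Finset.le_sup hq)).trans_le hm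
  have hm₀ : m ≠ 0 := (Nat.zero_lt_of_lt (hlt _ hp.e_mem)).ne'
  have hzero : ∀ q ∈ p, val q = 0 ↔ q.1 = A.e := fun q hq => (hp.eq_iff q hq _ hp.e_mem).symm
  refine ⟨insert (x, m) p, hp.insert hA limit_isSIASe hx (fun q hq => (hlt q hq).ne) ?_ ?_ ?_,
    Finset.subset_insert _ _, m, Finset.mem_insert_self _ _⟩
  · intro q hq r hr
    change _ ↔ (m, val q, val r) ∈ limitT
    by_cases hq₀ : val q = 0
    · rw [(hzero q hq).1 hq₀, ← hA.eq_iff, hq₀, mem_limitT]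
      have := hx r hr
      have := hlt r hr
      grind
    by_cases hr₀ : val r = 0
    · rw [(hzero r hr).1 hr₀, hA.swap_right_iff, ← hA.eq_iff, hr₀, mem_limitT]
      have := hx q hq
      have := hlt q hq
      grind
    rw [mem_limitT_of_lt (hlt q hq) (hlt r hr) hq₀ hr₀, hcode, hD₁ q hq r hr]
  · intro q hq
    change _ ↔ (m, m, val q) ∈ limitT
    by_cases hq₀ : val q = 0
    · rw [(hzero q hq).1 hq₀, hA.swap_right_iff, ← hA.eq_iff, hq₀, mem_limitT]
      grind
    rw [mem_limitT_self_of_lt (hlt q hq) hq₀, hcode, hD₂ q hq]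
  · rw [← hD₃, ← hcode]
    exact (mem_limitT_self hm₀).symm

end SigStr

/-- `FSIAS_e` has a Fraïssé limit: there is a countable ultrahomogeneous
structure whose age is, up to isomorphism, exactly `FSIAS_e`. -/
theorem stmt5 :
    ∃ F : SigStr, Countable F.carrier ∧ F.Ultrahomogeneous ∧
      ∀ A : SigStr, A.InAge F ↔ A.IsFSIASe := by
  have hc : Countable SigStr.limit.carrier := inferInstanceAs (Countable ℕ)
  refine ⟨SigStr.limit, hc, SigStr.limit_isSIASe.ultrahomogeneous
    (SigStr.extendsFrom_limit SigStr.limit_isSIASe), fun A => ?_⟩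
  rw [SigStr.isFSIASe_iff]
  constructor
  · rintro ⟨hfg, ⟨i⟩⟩
    have hA := SigStr.limit_isSIASe.of_emb i
    exact ⟨Set.finite_univ_iff.1 (hA.finite_of_fg hfg), hA⟩
  · rintro ⟨hfin, hA⟩
    exact ⟨A.fg_univ_of_finite,
      (SigStr.extendsFrom_limit hA).nonempty_emb hA SigStr.limit_isSIASe⟩
end

section
/- Let U be an n-element set, let e ∈ U, let f be an involution of U with f(e) = e, let I = {e}, and let s = |{a ∈ U : f(a) = a}|. Then: (1) there are exactly s - 1 diversity cycles containing exactly 1 triple, namely those of the form [a,a,a]; (2) there are exactly (n-s)/2 diversity cycles containing exactly 2 triples, namely those of the form [a,a,f(a)] with f(a) ≠ a; (3) there are exactly (s-1)(n-2) diversity cycles containing exactly 3 triples, namely those of the form [a,b,b] with f(a) = a and a ≠ b. -/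
/-- The cycle `[a,b,c]`: the set of the six Peircean transforms of `(a,b,c)`. -/
def cycle {U : Type*} [DecidableEq U] (f : U → U) (a b c : U) : Finset (U × U × U) :=
  {(a, b, c), (f a, c, b), (b, f c, f a), (f b, f a, f c), (f c, a, f b), (c, f b, a)}

/-- A finset of triples is a cycle (with respect to `f`). -/
def IsCycle {U : Type*} [DecidableEq U] (f : U → U) (C : Finset (U × U × U)) : Prop :=
  ∃ a b c, C = cycle f a b c

/-- With `I = {e}`, a set of triples is a diversity set iff none of its triples
has an entry equal to `e`. -/
def IsDiversity {U : Type*} (e : U) (C : Finset (U × U × U)) : Prop :=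
  ∀ t ∈ C, t.1 ≠ e ∧ t.2.1 ≠ e ∧ t.2.2 ≠ e

section CycleLemmas

variable {U : Type*} [DecidableEq U] {f : U → U}

/-- A cycle is invariant under the order-three Peircean rotation. -/
theorem cycle_rotate (hinv : ∀ x, f (f x) = x) (a b c : U) :
    cycle f b (f c) (f a) = cycle f a b c := by
  ext t
  simp only [cycle, hinv, Finset.mem_insert, Finset.mem_singleton]
  tauto

theorem cycle_self {a : U} (ha : f a = a) : cycle f a a a = {(a, a, a)} := by
  simp [cycle, ha]

theorem cycle_self_image (hinv : ∀ x, f (f x) = x) (a : U) :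
    cycle f a a (f a) = {(a, a, f a), (f a, f a, a)} := by
  ext t
  simp only [cycle, hinv, Finset.mem_insert, Finset.mem_singleton]
  tauto

theorem cycle_fixed {a : U} (ha : f a = a) (b : U) :
    cycle f a b b = {(a, b, b), (b, f b, a), (f b, a, f b)} := by
  ext t
  simp only [cycle, ha, Finset.mem_insert, Finset.mem_singleton]
  tauto

theorem card_cycle_self {a : U} (ha : f a = a) : (cycle f a a a).card = 1 := by
  simp [cycle_self ha]

theorem card_cycle_self_image (hinv : ∀ x, f (f x) = x) {a : U} (ha : f a ≠ a) :
    (cycle f a a (f a)).card = 2 := by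
  rw [cycle_self_image hinv, Finset.card_pair]
  simp [ha.symm]

theorem card_cycle_fixed (hinv : ∀ x, f (f x) = x) {a b : U} (ha : f a = a) (hab : a ≠ b) :
    (cycle f a b b).card = 3 := by
  rw [cycle_fixed ha, Finset.card_eq_three]
  have := hinv b
  exact ⟨_, _, _, by grind, by grind, by grind, rfl⟩

/-- Every cycle has one of the three degenerate forms or has six triples. -/
theorem cycle_classification (hinv : ∀ x, f (f x) = x) (a b c : U) :
    (∃ x, f x = x ∧ cycle f a b c = cycle f x x x) ∨
    (∃ x, f x ≠ x ∧ cycle f a b c = cycle f x x (f x)) ∨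
    (∃ x y, f x = x ∧ x ≠ y ∧ cycle f a b c = cycle f x y y) ∨
    (cycle f a b c).card = 6 := by
  have fixed (x y : U) (hx : f x = x) (h : cycle f a b c = cycle f x y y) :
      (∃ x, f x = x ∧ cycle f a b c = cycle f x x x) ∨
      (∃ x, f x ≠ x ∧ cycle f a b c = cycle f x x (f x)) ∨
      (∃ x y, f x = x ∧ x ≠ y ∧ cycle f a b c = cycle f x y y) ∨
      (cycle f a b c).card = 6 := by
    by_cases hxy : x = y
    · subst hxy
      exact Or.inl ⟨x, hx, h⟩
    · exact Or.inr (Or.inr (Or.inl ⟨x, y, hx, hxy, h⟩))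
  by_cases h2 : f a = a ∧ b = c
  · obtain ⟨ha, rfl⟩ := h2
    exact fixed a b ha rfl
  by_cases h4 : f c = c ∧ b = f a
  · obtain ⟨hc, rfl⟩ := h4
    exact fixed c a hc (by
      rw [← cycle_rotate hinv, ← cycle_rotate hinv, hinv, hc])
  by_cases h6 : f b = b ∧ c = a
  · obtain ⟨hb, rfl⟩ := h6
    exact fixed b (f c) hb (cycle_rotate hinv c b c).symm
  by_cases h3 : a = b ∧ c = f a
  · obtain ⟨rfl, rfl⟩ := h3
    by_cases ha : f a = a
    · exact Or.inl ⟨a, ha, by rw [ha]⟩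
    · exact Or.inr (Or.inl ⟨a, ha, rfl⟩)
  refine Or.inr (Or.inr (Or.inr ?_))
  have ha := hinv a
  have hb := hinv b
  have hc := hinv c
  unfold cycle
  repeat rw [Finset.card_insert_of_notMem]
  · simp
  all_goals
    simp only [Finset.mem_insert, Finset.mem_singleton, Prod.mk.injEq]
    grind

theorem IsDiversity.ne_of_cycle {e a b c : U} (h : IsDiversity e (cycle f a b c)) :
    a ≠ e ∧ b ≠ e ∧ c ≠ e :=
  h (a, b, c) (by simp [cycle])

theorem isDiversity_cycle (hinv : ∀ x, f (f x) = x) {e a b c : U} (hfe : f e = e)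
    (ha : a ≠ e) (hb : b ≠ e) (hc : c ≠ e) : IsDiversity e (cycle f a b c) := by
  have key (x : U) (hx : x ≠ e) : f x ≠ e := fun h => hx (by rw [← hinv x, h, hfe])
  have ha' := key a ha
  have hb' := key b hb
  have hc' := key c hc
  intro t ht
  simp only [cycle, Finset.mem_insert, Finset.mem_singleton] at ht
  rcases ht with rfl | rfl | rfl | rfl | rfl | rfl <;>
    exact ⟨by assumption, by assumption, by assumption⟩

theorem isDiversity_card_one_iff (hinv : ∀ x, f (f x) = x) {e : U} (hfe : f e = e)
    (C : Finset (U × U × U)) :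
    (IsCycle f C ∧ IsDiversity e C ∧ C.card = 1) ↔
      ∃ a, a ≠ e ∧ f a = a ∧ C = cycle f a a a := by
  constructor
  · rintro ⟨⟨a, b, c, rfl⟩, hd, hcard⟩
    rcases cycle_classification hinv a b c with ⟨x, hx, h⟩ | ⟨x, hx, h⟩ | ⟨x, y, hx, hxy, h⟩ | h
    · rw [h] at hd
      exact ⟨x, hd.ne_of_cycle.1, hx, h⟩
    · rw [h, card_cycle_self_image hinv hx] at hcard
      omega
    · rw [h, card_cycle_fixed hinv hx hxy] at hcard
      omega
    · omega
  · rintro ⟨a, ha, hfa, rfl⟩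
    exact ⟨⟨_, _, _, rfl⟩, isDiversity_cycle hinv hfe ha ha ha, card_cycle_self hfa⟩

theorem isDiversity_card_two_iff (hinv : ∀ x, f (f x) = x) {e : U} (hfe : f e = e)
    (C : Finset (U × U × U)) :
    (IsCycle f C ∧ IsDiversity e C ∧ C.card = 2) ↔
      ∃ a, a ≠ e ∧ f a ≠ a ∧ C = cycle f a a (f a) := by
  constructor
  · rintro ⟨⟨a, b, c, rfl⟩, hd, hcard⟩
    rcases cycle_classification hinv a b c with ⟨x, hx, h⟩ | ⟨x, hx, h⟩ | ⟨x, y, hx, hxy, h⟩ | h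
    · rw [h, card_cycle_self hx] at hcard
      omega
    · rw [h] at hd
      exact ⟨x, hd.ne_of_cycle.1, hx, h⟩
    · rw [h, card_cycle_fixed hinv hx hxy] at hcard
      omega
    · omega
  · rintro ⟨a, ha, hfa, rfl⟩
    have : f a ≠ e := fun h => ha (by rw [← hinv a, h, hfe])
    exact ⟨⟨_, _, _, rfl⟩, isDiversity_cycle hinv hfe ha ha this, card_cycle_self_image hinv hfa⟩

theorem isDiversity_card_three_iff (hinv : ∀ x, f (f x) = x) {e : U} (hfe : f e = e)
    (C : Finset (U × U × U)) :
    (IsCycle f C ∧ IsDiversity e C ∧ C.card = 3) ↔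
      ∃ a b, a ≠ e ∧ b ≠ e ∧ f a = a ∧ a ≠ b ∧ C = cycle f a b b := by
  constructor
  · rintro ⟨⟨a, b, c, rfl⟩, hd, hcard⟩
    rcases cycle_classification hinv a b c with ⟨x, hx, h⟩ | ⟨x, hx, h⟩ | ⟨x, y, hx, hxy, h⟩ | h
    · rw [h, card_cycle_self hx] at hcard
      omega
    · rw [h, card_cycle_self_image hinv hx] at hcard
      omega
    · rw [h] at hd
      exact ⟨x, y, hd.ne_of_cycle.1, hd.ne_of_cycle.2.1, hx, hxy, h⟩
    · omega
  · rintro ⟨a, b, ha, hb, hfa, hab, rfl⟩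
    exact ⟨⟨_, _, _, rfl⟩, isDiversity_cycle hinv hfe ha hb hb, card_cycle_fixed hinv hfa hab⟩

theorem cycle_self_image_eq_iff (hinv : ∀ x, f (f x) = x) (a b : U) :
    cycle f a a (f a) = cycle f b b (f b) ↔ a = b ∨ a = f b := by
  constructor
  · intro h
    have hm : (a, a, f a) ∈ cycle f b b (f b) := h ▸ by simp [cycle]
    simp only [cycle_self_image hinv, Finset.mem_insert, Finset.mem_singleton,
      Prod.mk.injEq] at hm
    tauto
  · rintro (rfl | rfl)
    · rfl
    · rw [cycle_self_image hinv, cycle_self_image hinv, hinv, Finset.pair_comm]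

theorem cycle_fixed_inj (hinv : ∀ x, f (f x) = x) {a b a' b' : U} (ha' : f a' = a')
    (hab' : a' ≠ b') (h : cycle f a b b = cycle f a' b' b') : a = a' ∧ b = b' := by
  have hm : (a, b, b) ∈ cycle f a' b' b' := h ▸ by simp [cycle]
  have := hinv b'
  simp only [cycle_fixed ha', Finset.mem_insert, Finset.mem_singleton,
    Prod.mk.injEq] at hm
  grind

theorem two_mul_card_image_cycle_self_image [Fintype U] (hinv : ∀ x, f (f x) = x) :
    2 * ((Finset.univ.filter fun a => f a ≠ a).image fun a => cycle f a a (f a)).card =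
      (Finset.univ.filter fun a => f a ≠ a).card := by
  rw [Finset.card_eq_sum_card_image (fun a => cycle f a a (f a))
    (Finset.univ.filter fun a => f a ≠ a), Finset.sum_const_nat (m := 2), mul_comm]
  intro C hC
  obtain ⟨b, hb, rfl⟩ := Finset.mem_image.mp hC
  have hfb : f b ≠ b := by simpa using hb
  rw [← Finset.card_pair hfb.symm]
  congr 1
  ext a
  have := hinv b
  simp only [Finset.mem_filter, Finset.mem_univ, true_and, cycle_self_image_eq_iff hinv,
    Finset.mem_insert, Finset.mem_singleton]
  grind

end CycleLemmas

/-- Counts of diversity cycles with 1, 2, and 3 triples, together with their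
characterizations: there are `s - 1` diversity cycles with exactly one triple,
namely those of the form `[a,a,a]`; `(n-s)/2` with exactly two triples, namely
those of the form `[a,a,f(a)]` with `f(a) ≠ a`; and `(s-1)(n-2)` with exactly
three triples, namely those of the form `[a,b,b]` with `f(a) = a` and `a ≠ b`. -/
theorem stmt13 {U : Type*} [Fintype U] [DecidableEq U] (n : ℕ)
    (hn : Fintype.card U = n) (e : U) (f : U → U)
    (hinv : ∀ x, f (f x) = x) (hfe : f e = e)
    (s : ℕ) (hs : s = Nat.card {a : U // f a = a}) :
    (Nat.card {C : Finset (U × U × U) //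
        IsCycle f C ∧ IsDiversity e C ∧ C.card = 1} = s - 1 ∧
      {C : Finset (U × U × U) | IsCycle f C ∧ IsDiversity e C ∧ C.card = 1} =
        {C | ∃ a, a ≠ e ∧ f a = a ∧ C = cycle f a a a}) ∧
    (Nat.card {C : Finset (U × U × U) //
        IsCycle f C ∧ IsDiversity e C ∧ C.card = 2} = (n - s) / 2 ∧
      {C : Finset (U × U × U) | IsCycle f C ∧ IsDiversity e C ∧ C.card = 2} =
        {C | ∃ a, a ≠ e ∧ f a ≠ a ∧ C = cycle f a a (f a)}) ∧
    (Nat.card {C : Finset (U × U × U) //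
        IsCycle f C ∧ IsDiversity e C ∧ C.card = 3} = (s - 1) * (n - 2) ∧
      {C : Finset (U × U × U) | IsCycle f C ∧ IsDiversity e C ∧ C.card = 3} =
        {C | ∃ a b, a ≠ e ∧ b ≠ e ∧ f a = a ∧ a ≠ b ∧ C = cycle f a b b}) := by
  have hs' : (Finset.univ.filter fun a => f a = a).card = s := by
    rw [hs, Nat.card_eq_fintype_card, Fintype.card_subtype]
  have hfix : ((Finset.univ.filter fun a => f a = a).erase e).card = s - 1 := by
    rw [Finset.card_erase_of_mem (by simp [hfe]), hs']
  refine ⟨⟨?_, Set.ext (isDiversity_card_one_iff hinv hfe)⟩,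
    ⟨?_, Set.ext (isDiversity_card_two_iff hinv hfe)⟩,
    ⟨?_, Set.ext (isDiversity_card_three_iff hinv hfe)⟩⟩
  · rw [Nat.subtype_card
      (((Finset.univ.filter fun a => f a = a).erase e).image fun a => cycle f a a a)]
    · rw [Finset.card_image_of_injOn, hfix]
      intro a ha b hb h
      have ha' : f a = a := by simp_all
      have hb' : f b = b := by simp_all
      simpa [cycle_self ha', cycle_self hb'] using h
    · intro C
      rw [isDiversity_card_one_iff hinv hfe]
      simp [and_assoc, eq_comm]
  · rw [Nat.subtype_card ((Finset.univ.filter fun a => f a ≠ a).image fun a => cycle f a a (f a))]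
    · have h2 := two_mul_card_image_cycle_self_image hinv
      have hsum := Finset.card_filter_add_card_filter_not (s := Finset.univ) (fun a => f a = a)
      rw [Finset.card_univ] at hsum
      simp only [← ne_eq] at hsum
      omega
    · intro C
      rw [isDiversity_card_two_iff hinv hfe]
      simp only [Finset.mem_image, Finset.mem_filter, Finset.mem_univ, true_and]
      constructor
      · rintro ⟨a, ha, rfl⟩
        exact ⟨a, fun h => ha (h ▸ hfe), ha, rfl⟩
      · rintro ⟨a, -, ha, rfl⟩
        exact ⟨a, ha, rfl⟩
  · rw [Nat.subtype_card
      ((((Finset.univ.filter fun a => f a = a).erase e).sigma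
        fun a => (Finset.univ.erase e).erase a).image fun p => cycle f p.1 p.2 p.2)]
    · rw [Finset.card_image_of_injOn, Finset.card_sigma, Finset.sum_const_nat (m := n - 2), hfix]
      · intro a ha
        rw [Finset.card_erase_of_mem (by simp_all), Finset.card_erase_of_mem (by simp),
          Finset.card_univ, hn, Nat.sub_sub]
      · rintro ⟨a, b⟩ - ⟨a', b'⟩ hp h
        have hp' : (f a' = a' ∧ a' ≠ e) ∧ b' ≠ e ∧ b' ≠ a' := by simpa using hp
        obtain ⟨rfl, rfl⟩ := cycle_fixed_inj hinv hp'.1.1 hp'.2.2.symm h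
        rfl
    · intro C
      rw [isDiversity_card_three_iff hinv hfe]
      simp only [Finset.mem_image, Finset.mem_sigma, Finset.mem_erase, Finset.mem_filter,
        Finset.mem_univ, true_and, and_true, Sigma.exists]
      grind
end

section
/- Let U be an n-element set, let e ∈ U, let f be an involution of U with f(e) = e, let I = {e}, and let s = |{a ∈ U : f(a) = a}|. Then there are exactly (n-1)((n-1)² - 3s + 2)/6 + (s-1)/2 diversity cycles containing exactly 6 triples, and the total number of diversity cycles is Q(n,s) := (n-1)((n-1)² + 3s - 1)/6. -/
namespace PeirceanCycle

open Finset

variable {U : Type*} [DecidableEq U] {f : U → U}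

/-- `(a, b, c)` is fixed by the transform `(a, b, c) ↦ (f a, c, b)`. -/
def FixedFst (f : U → U) (t : U × U × U) : Prop := f t.1 = t.1 ∧ t.2.1 = t.2.2

/-- `(a, b, c)` is fixed by the transform `(a, b, c) ↦ (f b, f a, f c)`. -/
def FixedThd (f : U → U) (t : U × U × U) : Prop := f t.1 = t.2.1 ∧ f t.2.2 = t.2.2

/-- `(a, b, c)` is fixed by the transform `(a, b, c) ↦ (c, f b, a)`. -/
def FixedSnd (f : U → U) (t : U × U × U) : Prop := t.1 = t.2.2 ∧ f t.2.1 = t.2.1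

/-- `(a, b, c)` is fixed by the transform `(a, b, c) ↦ (b, f c, f a)` of order three. -/
def FixedRot (f : U → U) (t : U × U × U) : Prop := t.1 = t.2.1 ∧ f t.1 = t.2.2

/-- `(a, b, c)` is fixed by all Peircean transforms. -/
def FixedAll (f : U → U) (t : U × U × U) : Prop := t.1 = t.2.1 ∧ t.1 = t.2.2 ∧ f t.1 = t.1

instance : DecidablePred (FixedFst f) := fun _ => inferInstanceAs (Decidable (_ ∧ _))
instance : DecidablePred (FixedThd f) := fun _ => inferInstanceAs (Decidable (_ ∧ _))
instance : DecidablePred (FixedSnd f) := fun _ => inferInstanceAs (Decidable (_ ∧ _))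
instance : DecidablePred (FixedRot f) := fun _ => inferInstanceAs (Decidable (_ ∧ _))
instance : DecidablePred (FixedAll f) := fun _ => inferInstanceAs (Decidable (_ ∧ _ ∧ _))

/-- The cycle of a triple. -/
def cycleOf (f : U → U) (t : U × U × U) : Finset (U × U × U) := cycle f t.1 t.2.1 t.2.2

lemma mem_cycleOf_self (t : U × U × U) : t ∈ cycleOf f t := by
  simp [cycleOf, cycle]

lemma cycleOf_eq_of_mem (hf : ∀ x, f (f x) = x) {t u : U × U × U} (h : u ∈ cycleOf f t) :
    cycleOf f u = cycleOf f t := by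
  obtain ⟨a, b, c⟩ := t
  simp only [cycleOf, cycle, mem_insert, mem_singleton] at h
  rcases h with rfl | h
  · rfl
  rcases h with rfl | rfl | rfl | rfl | rfl <;>
    · simp only [cycleOf, cycle, hf]
      ext x
      simp only [mem_insert, mem_singleton]
      tauto

lemma cycleOf_eq_iff (hf : ∀ x, f (f x) = x) {t u : U × U × U} :
    cycleOf f u = cycleOf f t ↔ u ∈ cycleOf f t :=
  ⟨fun h => h ▸ mem_cycleOf_self u, cycleOf_eq_of_mem hf⟩

lemma card_cycleOf_of_fixedAll {t : U × U × U} (h : FixedAll f t) : #(cycleOf f t) = 1 := by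
  obtain ⟨a, b, c⟩ := t
  obtain ⟨rfl, rfl, h⟩ : a = b ∧ a = c ∧ f a = a := h
  simp [cycleOf, cycle, h]

lemma card_cycleOf_of_fixedRot (hf : ∀ x, f (f x) = x) {t : U × U × U} (h : FixedRot f t)
    (h' : ¬ FixedAll f t) : #(cycleOf f t) = 2 := by
  obtain ⟨a, b, c⟩ := t
  obtain ⟨rfl, rfl⟩ : a = b ∧ f a = c := h
  have hs : cycleOf f (a, a, f a) = {(a, a, f a), (f a, f a, a)} := by
    ext x
    simp only [cycleOf, cycle, hf, mem_insert, mem_singleton]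
    tauto
  rw [hs, card_pair]
  simp only [FixedAll] at h'
  grind

lemma card_cycleOf_of_fixedFst {t : U × U × U} (h : FixedFst f t)
    (h' : ¬ FixedAll f t) : #(cycleOf f t) = 3 := by
  obtain ⟨a, b, c⟩ := t
  obtain ⟨h, rfl⟩ : f a = a ∧ b = c := h
  have hs : cycleOf f (a, b, b) = {(a, b, b), (b, f b, a), (f b, a, f b)} := by
    ext x
    simp only [cycleOf, cycle, h, mem_insert, mem_singleton]
    tauto
  rw [hs, card_eq_three]
  simp only [FixedAll] at h'
  exact ⟨_, _, _, by grind, by grind, by grind, rfl⟩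

lemma card_cycleOf_of_fixedThd (hf : ∀ x, f (f x) = x) {t : U × U × U} (h : FixedThd f t)
    (h' : ¬ FixedAll f t) : #(cycleOf f t) = 3 := by
  obtain ⟨a, b, c⟩ := t
  obtain ⟨rfl, h⟩ : f a = b ∧ f c = c := h
  rw [← cycleOf_eq_of_mem hf (u := (c, a, a)) (by simp [cycleOf, cycle, h, hf])]
  exact card_cycleOf_of_fixedFst ⟨h, rfl⟩ (by simp only [FixedAll] at h' ⊢; grind)

lemma card_cycleOf_of_fixedSnd (hf : ∀ x, f (f x) = x) {t : U × U × U} (h : FixedSnd f t)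
    (h' : ¬ FixedAll f t) : #(cycleOf f t) = 3 := by
  obtain ⟨a, b, c⟩ := t
  obtain ⟨rfl, h⟩ : a = c ∧ f b = b := h
  rw [← cycleOf_eq_of_mem hf (u := (b, f a, f a)) (by simp [cycleOf, cycle])]
  exact card_cycleOf_of_fixedFst ⟨h, rfl⟩ (by simp only [FixedAll] at h' ⊢; grind)

lemma card_cycleOf_of_not_fixed (hf : ∀ x, f (f x) = x) {t : U × U × U} (h₁ : ¬ FixedFst f t)
    (h₂ : ¬ FixedSnd f t) (h₃ : ¬ FixedThd f t) (h₄ : ¬ FixedRot f t) :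
    #(cycleOf f t) = 6 := by
  obtain ⟨a, b, c⟩ := t
  simp only [FixedFst, FixedSnd, FixedThd, FixedRot] at h₁ h₂ h₃ h₄
  have ha := hf a
  have hb := hf b
  have hc := hf c
  rw [cycleOf, cycle, card_insert_of_notMem, card_insert_of_notMem, card_insert_of_notMem,
    card_insert_of_notMem, card_insert_of_notMem, card_singleton] <;>
  · simp only [mem_insert, mem_singleton, Prod.mk.injEq]
    grind

/-- The orbit-stabilizer relation for the Peircean transforms. -/
lemma inv_card_cycleOf (hf : ∀ x, f (f x) = x) (t : U × U × U) :
    (#(cycleOf f t) : ℚ)⁻¹ = (1 + (if FixedFst f t then 1 else 0) +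
      (if FixedSnd f t then 1 else 0) + (if FixedThd f t then 1 else 0) +
      2 * (if FixedRot f t then 1 else 0)) / 6 ∧
    (if #(cycleOf f t) = 6 then (#(cycleOf f t) : ℚ)⁻¹ else 0) =
      (1 - (if FixedFst f t then 1 else 0) - (if FixedSnd f t then 1 else 0) -
      (if FixedThd f t then 1 else 0) - (if FixedRot f t then 1 else 0) +
      3 * (if FixedAll f t then 1 else 0)) / 6 := by
  have key : (FixedAll f t ∧ FixedFst f t ∧ FixedSnd f t ∧ FixedThd f t ∧ FixedRot f t) ∨
      (¬ FixedAll f t ∧ ((FixedFst f t ∧ ¬ FixedSnd f t ∧ ¬ FixedThd f t ∧ ¬ FixedRot f t) ∨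
        (¬ FixedFst f t ∧ FixedSnd f t ∧ ¬ FixedThd f t ∧ ¬ FixedRot f t) ∨
        (¬ FixedFst f t ∧ ¬ FixedSnd f t ∧ FixedThd f t ∧ ¬ FixedRot f t) ∨
        (¬ FixedFst f t ∧ ¬ FixedSnd f t ∧ ¬ FixedThd f t ∧ FixedRot f t) ∨
        (¬ FixedFst f t ∧ ¬ FixedSnd f t ∧ ¬ FixedThd f t ∧ ¬ FixedRot f t))) := by
    have h₁ := hf t.1
    have h₂ := hf t.2.1
    have h₃ := hf t.2.2
    simp only [FixedAll, FixedFst, FixedSnd, FixedThd, FixedRot]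
    grind (splits := 40)
  rcases key with ⟨h₀, h₁, h₂, h₃, h₄⟩ | ⟨h₀, ⟨h₁, h₂, h₃, h₄⟩ | ⟨h₁, h₂, h₃, h₄⟩ |
    ⟨h₁, h₂, h₃, h₄⟩ | ⟨h₁, h₂, h₃, h₄⟩ | ⟨h₁, h₂, h₃, h₄⟩⟩
  · simp only [card_cycleOf_of_fixedAll h₀, h₀, h₁, h₂, h₃, h₄, if_true]
    norm_num
  · simp only [card_cycleOf_of_fixedFst h₁ h₀, h₀, h₁, h₂, h₃, h₄, if_true, if_false]
    norm_num
  · simp only [card_cycleOf_of_fixedSnd hf h₂ h₀, h₀, h₁, h₂, h₃, h₄, if_true, if_false]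
    norm_num
  · simp only [card_cycleOf_of_fixedThd hf h₃ h₀, h₀, h₁, h₂, h₃, h₄, if_true, if_false]
    norm_num
  · simp only [card_cycleOf_of_fixedRot hf h₄ h₀, h₀, h₁, h₂, h₃, h₄, if_true, if_false]
    norm_num
  · simp only [card_cycleOf_of_not_fixed hf h₁ h₂ h₃ h₄, h₀, h₁, h₂, h₃, h₄, if_true, if_false]
    norm_num

section Counting

variable {V : Finset U}

lemma cycleOf_subset (hV : ∀ x ∈ V, f x ∈ V) {t : U × U × U} (ht : t ∈ V ×ˢ V ×ˢ V) :
    cycleOf f t ⊆ V ×ˢ V ×ˢ V := by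
  obtain ⟨a, b, c⟩ := t
  simp only [mem_product] at ht
  obtain ⟨ha, hb, hc⟩ := ht
  intro u hu
  simp only [cycleOf, cycle, mem_insert, mem_singleton] at hu
  rcases hu with rfl | rfl | rfl | rfl | rfl | rfl <;> simp [ha, hb, hc, hV]

/-- Counting cycles by summing the reciprocals of their sizes over all triples. -/
lemma card_filter_image_cycleOf (hf : ∀ x, f (f x) = x) (hV : ∀ x ∈ V, f x ∈ V) (p : ℕ → Prop)
    [DecidablePred p] :
    (#{C ∈ (V ×ˢ V ×ˢ V).image (cycleOf f) | p #C} : ℚ) =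
      ∑ t ∈ V ×ˢ V ×ˢ V, if p #(cycleOf f t) then (#(cycleOf f t) : ℚ)⁻¹ else 0 := by
  rw [sum_comp (fun C : Finset (U × U × U) => if p #C then (#C : ℚ)⁻¹ else 0) (cycleOf f),
    card_filter, Nat.cast_sum]
  refine sum_congr rfl fun C hC => ?_
  obtain ⟨t, ht, rfl⟩ := mem_image.1 hC
  have hfib : {u ∈ V ×ˢ V ×ˢ V | cycleOf f u = cycleOf f t} = cycleOf f t := by
    ext u
    rw [mem_filter, cycleOf_eq_iff hf]
    exact ⟨And.right, fun h => ⟨cycleOf_subset hV ht h, h⟩⟩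
  have hpos : (#(cycleOf f t) : ℚ) ≠ 0 :=
    Nat.cast_ne_zero.2 (card_ne_zero_of_mem (mem_cycleOf_self t))
  rw [hfib]
  split_ifs <;> simp [hpos]

lemma card_fixedFst :
    #{t ∈ V ×ˢ V ×ˢ V | FixedFst f t} = #{a ∈ V | f a = a} * #V := by
  rw [← card_product]
  refine card_nbij' (fun t => (t.1, t.2.1)) (fun p => (p.1, p.2, p.2)) ?_ ?_ ?_ ?_ <;>
    simp [Set.MapsTo, Set.LeftInvOn, FixedFst] <;> grind

lemma card_fixedSnd :
    #{t ∈ V ×ˢ V ×ˢ V | FixedSnd f t} = #{a ∈ V | f a = a} * #V := by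
  rw [← card_product]
  refine card_nbij' (fun t => (t.2.1, t.1)) (fun p => (p.2, p.1, p.2)) ?_ ?_ ?_ ?_ <;>
    simp [Set.MapsTo, Set.LeftInvOn, FixedSnd] <;> grind

lemma card_fixedThd (hV : ∀ x ∈ V, f x ∈ V) :
    #{t ∈ V ×ˢ V ×ˢ V | FixedThd f t} = #{a ∈ V | f a = a} * #V := by
  rw [← card_product]
  refine card_nbij' (fun t => (t.2.2, t.1)) (fun p => (p.2, f p.2, p.1)) ?_ ?_ ?_ ?_ <;>
    simp [Set.MapsTo, Set.LeftInvOn, FixedThd] <;> grind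

lemma card_fixedRot (hV : ∀ x ∈ V, f x ∈ V) :
    #{t ∈ V ×ˢ V ×ˢ V | FixedRot f t} = #V := by
  refine card_nbij' (fun t => t.1) (fun a => (a, a, f a)) ?_ ?_ ?_ ?_ <;>
    simp [Set.MapsTo, Set.LeftInvOn, FixedRot] <;> grind

lemma card_fixedAll :
    #{t ∈ V ×ˢ V ×ˢ V | FixedAll f t} = #{a ∈ V | f a = a} := by
  refine card_nbij' (fun t => t.1) (fun a => (a, a, a)) ?_ ?_ ?_ ?_ <;>
    simp [Set.MapsTo, Set.LeftInvOn, FixedAll] <;> grind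

/-- The number of cycles over an `f`-closed set. -/
lemma card_image_cycleOf (hf : ∀ x, f (f x) = x) (hV : ∀ x ∈ V, f x ∈ V) :
    (#((V ×ˢ V ×ˢ V).image (cycleOf f)) : ℚ) =
      ((#V : ℚ) ^ 3 + 3 * (#{a ∈ V | f a = a} * #V) + 2 * #V) / 6 := by
  have h := card_filter_image_cycleOf hf hV (fun _ => True)
  simp only [filter_true, if_true, (inv_card_cycleOf hf _).1] at h
  rw [h, ← sum_div]
  simp only [sum_add_distrib, ← mul_sum, sum_boole, card_fixedFst, card_fixedSnd,
    card_fixedThd hV, card_fixedRot hV, sum_const, card_product, nsmul_eq_mul]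
  push_cast
  ring

/-- The number of six-element cycles over an `f`-closed set. -/
lemma card_image_cycleOf_card_eq_six (hf : ∀ x, f (f x) = x) (hV : ∀ x ∈ V, f x ∈ V) :
    (#{C ∈ (V ×ˢ V ×ˢ V).image (cycleOf f) | #C = 6} : ℚ) =
      ((#V : ℚ) ^ 3 - 3 * (#{a ∈ V | f a = a} * #V) - #V + 3 * #{a ∈ V | f a = a}) / 6 := by
  have h := card_filter_image_cycleOf hf hV (fun k => k = 6)
  simp only [(inv_card_cycleOf hf _).2] at h
  rw [h, ← sum_div]
  simp only [sum_add_distrib, sum_sub_distrib, ← mul_sum, sum_boole, card_fixedFst, card_fixedSnd,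
    card_fixedThd hV, card_fixedRot hV, card_fixedAll, sum_const, card_product, nsmul_eq_mul]
  push_cast
  ring

end Counting

lemma mem_image_cycleOf_erase_iff [Fintype U] {e : U} (hV : ∀ x ∈ univ.erase e, f x ∈ univ.erase e)
    (C : Finset (U × U × U)) :
    C ∈ (univ.erase e ×ˢ univ.erase e ×ˢ univ.erase e).image (cycleOf f) ↔
      IsCycle f C ∧ IsDiversity e C := by
  rw [mem_image]
  constructor
  · rintro ⟨t, ht, rfl⟩
    refine ⟨⟨t.1, t.2.1, t.2.2, rfl⟩, fun u hu => ?_⟩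
    simpa using cycleOf_subset hV ht hu
  · rintro ⟨⟨a, b, c, rfl⟩, h⟩
    refine ⟨(a, b, c), ?_, rfl⟩
    simpa using h (a, b, c) (mem_cycleOf_self (f := f) (a, b, c))

end PeirceanCycle

/-- There are exactly `(n-1)((n-1)² - 3s + 2)/6 + (s-1)/2` diversity cycles with
exactly 6 triples, and `Q(n,s) = (n-1)((n-1)² + 3s - 1)/6` diversity cycles in
total. -/
theorem stmt14 {U : Type*} [Fintype U] [DecidableEq U] (n : ℕ)
    (hn : Fintype.card U = n) (e : U) (f : U → U)
    (hinv : ∀ x, f (f x) = x) (hfe : f e = e)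
    (s : ℕ) (hs : s = Nat.card {a : U // f a = a}) :
    (Nat.card {C : Finset (U × U × U) //
        IsCycle f C ∧ IsDiversity e C ∧ C.card = 6} : ℚ) =
      ((n : ℚ) - 1) * (((n : ℚ) - 1) ^ 2 - 3 * (s : ℚ) + 2) / 6 + ((s : ℚ) - 1) / 2 ∧
    (Nat.card {C : Finset (U × U × U) // IsCycle f C ∧ IsDiversity e C} : ℚ) =
      ((n : ℚ) - 1) * (((n : ℚ) - 1) ^ 2 + 3 * (s : ℚ) - 1) / 6 := by
  have hV : ∀ x ∈ Finset.univ.erase e, f x ∈ Finset.univ.erase e := by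
    simp only [Finset.mem_erase, Finset.mem_univ, and_true]
    intro x hx h
    exact hx (by rw [← hinv x, h, hfe])
  have hcardV : ((Finset.univ.erase e).card : ℚ) = n - 1 := by
    rw [Finset.cast_card_erase_of_mem (Finset.mem_univ e), Finset.card_univ, hn]
  have hcardW : (({a ∈ Finset.univ.erase e | f a = a} : Finset U).card : ℚ) = s - 1 := by
    rw [Finset.filter_erase, Finset.cast_card_erase_of_mem (by simp [hfe]), hs,
      Nat.card_eq_fintype_card, Fintype.card_subtype]
  have hmem := PeirceanCycle.mem_image_cycleOf_erase_iff hV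
  constructor
  · rw [Nat.subtype_card (Finset.filter (fun C => C.card = 6) _)
        (fun C => by rw [Finset.mem_filter, hmem, and_assoc]),
      PeirceanCycle.card_image_cycleOf_card_eq_six hinv hV, hcardV, hcardW]
    ring
  · rw [Nat.subtype_card _ hmem, PeirceanCycle.card_image_cycleOf hinv hV, hcardV, hcardW]
    ring
end

section
/- Let U be an n-element set, let e ∈ U, let f be an involution of U with f(e) = e, and let s = |{a ∈ U : f(a) = a}|. Then the number of automorphisms of the structure ⟨U; f, {e}⟩ (i.e., bijections g : U → U with g ∘ f = f ∘ g and g(e) = e) is exactly P(n,s) := (s-1)! · ((n-s)/2)! · 2^{(n-s)/2}. -/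
open Equiv Equiv.Perm in
/-- The order of the centralizer of an involution, in terms of its number of fixed points. -/
theorem nat_card_centralizer_of_pow_two_eq_one {α : Type*} [Fintype α] [DecidableEq α]
    {σ : Perm α} (hσ : σ ^ 2 = 1) :
    Nat.card (Subgroup.centralizer {σ}) =
      (Nat.card (Function.fixedPoints σ)).factorial *
        ((Fintype.card α - Nat.card (Function.fixedPoints σ)) / 2).factorial *
        2 ^ ((Fintype.card α - Nat.card (Function.fixedPoints σ)) / 2) := by
  have hfix := card_fixedPoints σ
  have hle := sum_cycleType_le σ
  rw [Perm.nat_card_centralizer, Nat.card_eq_fintype_card, hfix, Nat.sub_sub_self hle,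
    cycleType_of_pow_prime_eq_one hσ]
  generalize σ.cycleType.card = k
  rcases Nat.eq_zero_or_pos k with rfl | hk
  · simp
  · simp [Multiset.toFinset_replicate, hk.ne', mul_assoc, mul_comm (2 ^ k)]

open Equiv in
/-- The centralizer of a permutation acts transitively on its fixed points. -/
theorem orbit_centralizer_eq_fixedPoints {α : Type*} [DecidableEq α] (σ : Perm α) {a : α}
    (ha : σ a = a) :
    MulAction.orbit (Subgroup.centralizer {σ}) a = Function.fixedPoints σ := by
  ext b
  constructor
  · rintro ⟨⟨g, hg⟩, rfl⟩
    have h := congrArg (· a) (Subgroup.mem_centralizer_singleton_iff.mp hg)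
    simp only [Perm.mul_apply, ha] at h
    exact h.symm
  · intro hb
    refine ⟨⟨swap a b, Subgroup.mem_centralizer_singleton_iff.mpr ?_⟩, swap_apply_left a b⟩
    rw [mul_swap_eq_swap_mul, ha, hb.eq]

/-- The number of automorphisms of `⟨U; f, {e}⟩` (bijections commuting with the
involution `f` and fixing `e`) is `P(n,s) = (s-1)! · ((n-s)/2)! · 2^{(n-s)/2}`,
where `s` is the number of fixed points of `f`. -/
theorem stmt15 {U : Type*} [Fintype U] [DecidableEq U] (n : ℕ)
    (hn : Fintype.card U = n) (e : U) (f : U → U)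
    (hinv : ∀ x, f (f x) = x) (hfe : f e = e)
    (s : ℕ) (hs : s = Nat.card {a : U // f a = a}) :
    Nat.card {g : Equiv.Perm U // (∀ x, g (f x) = f (g x)) ∧ g e = e} =
      Nat.factorial (s - 1) * Nat.factorial ((n - s) / 2) * 2 ^ ((n - s) / 2) := by
  let σ : Equiv.Perm U := Function.Involutive.toPerm f hinv
  have hσ : σ ^ 2 = 1 := (pow_two σ).trans (Equiv.ext hinv)
  have hfix : Nat.card (Function.fixedPoints σ) = s := hs.symm
  have hpos : 0 < s := by
    have : Nonempty {a : U // f a = a} := ⟨⟨e, hfe⟩⟩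
    exact hs ▸ Nat.card_pos
  have hcomm (g : Equiv.Perm U) :
      g ∈ Subgroup.centralizer {σ} ↔ ∀ x, g (f x) = f (g x) :=
    Subgroup.mem_centralizer_singleton_iff.trans Equiv.ext_iff
  have hstab : Nat.card {g : Equiv.Perm U // (∀ x, g (f x) = f (g x)) ∧ g e = e} =
      Nat.card (MulAction.stabilizer (Subgroup.centralizer {σ}) e) :=
    Nat.card_congr
      { toFun := fun g => ⟨⟨g.1, (hcomm _).mpr g.2.1⟩, g.2.2⟩
        invFun := fun g => ⟨g.1.1, (hcomm _).mp g.1.2, g.2⟩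
        left_inv := fun _ => rfl
        right_inv := fun _ => rfl }
  have horbit := (MulAction.stabilizer (Subgroup.centralizer {σ}) e).card_mul_index
  rw [MulAction.index_stabilizer, orbit_centralizer_eq_fixedPoints σ hfe,
    ← Nat.card_coe_set_eq, nat_card_centralizer_of_pow_two_eq_one hσ, hfix, hn,
    ← Nat.mul_factorial_pred hpos.ne'] at horbit
  rw [hstab]
  apply Nat.eq_of_mul_eq_mul_right hpos
  rw [horbit]
  ring
end

section
/- Let U be a set, f : U → U an involution, e ∈ U, and T ⊆ U³, and assume condition (IP) holds: whenever (a,b,c) ∈ T, also (f(a),c,b) ∈ T and (c,f(b),a) ∈ T. Then the following are equivalent: (i) for all a,b ∈ U, a = b if and only if (a,e,b) ∈ T (condition (II)); (ii) f(e) = e and the set of consistent identity cycles is exactly {[a,e,a] : a ∈ U}. -/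
/-- The cycle `[a,b,c]`: the set of the six Peircean transforms of `(a,b,c)`. -/
def cycleS {U : Type*} (f : U → U) (a b c : U) : Set (U × U × U) :=
  {(a, b, c), (f a, c, b), (b, f c, f a), (f b, f a, f c), (f c, a, f b), (c, f b, a)}

/-- A cycle is the cycle of each of its members. -/
theorem cycleS_eq_of_mem {U : Type*} {f : U → U} (hinv : ∀ x, f (f x) = x) {a b c x y z : U}
    (h : (x, y, z) ∈ cycleS f a b c) : cycleS f a b c = cycleS f x y z := by
  simp only [cycleS, Set.mem_insert_iff, Set.mem_singleton_iff, Prod.mk.injEq] at h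
  rcases h with ⟨rfl, rfl, rfl⟩ | ⟨rfl, rfl, rfl⟩ | ⟨rfl, rfl, rfl⟩ | ⟨rfl, rfl, rfl⟩ |
    ⟨rfl, rfl, rfl⟩ | ⟨rfl, rfl, rfl⟩
  · rfl
  all_goals
    ext t
    simp only [cycleS, Set.mem_insert_iff, Set.mem_singleton_iff, hinv]
    tauto

/-- A set of triples closed under the two generating transforms contains the cycle of each
of its members. -/
theorem cycleS_subset_of_mem {U : Type*} {f : U → U}
    {T : Set (U × U × U)}
    (hip : ∀ a b c : U, (a, b, c) ∈ T → (f a, c, b) ∈ T ∧ (c, f b, a) ∈ T) {a b c : U}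
    (h : (a, b, c) ∈ T) : cycleS f a b c ⊆ T := by
  obtain ⟨h₁, h₂⟩ := hip _ _ _ h
  have h₃ := (hip _ _ _ h₁).2
  have h₄ := (hip _ _ _ h₂).1
  have h₅ := (hip _ _ _ h₃).1
  simp only [cycleS, Set.insert_subset_iff, Set.singleton_subset_iff]
  exact ⟨h, h₁, h₃, h₅, h₄, h₂⟩

/-- An identity cycle contains a triple whose middle entry is `e`. -/
theorem exists_mid_mem_cycleS {U : Type*} {f : U → U} (hinv : ∀ x, f (f x) = x) {a b c e : U}
    (h : ∃ t ∈ cycleS f a b c, t.1 = e ∨ t.2.1 = e ∨ t.2.2 = e) :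
    ∃ x z, (x, e, z) ∈ cycleS f a b c := by
  obtain ⟨⟨x, y, z⟩, ht, h⟩ := h
  rw [cycleS_eq_of_mem hinv ht]
  rcases h with rfl | rfl | rfl
  · exact ⟨f z, f y, by simp [cycleS]⟩
  · exact ⟨x, z, by simp [cycleS]⟩
  · exact ⟨f x, y, by simp [cycleS]⟩

/-- Assuming (IP), condition (II) holds if and only if `f(e) = e` and the set of
consistent identity cycles is exactly `{[a,e,a] : a ∈ U}`. -/
theorem stmt17 {U : Type*} (f : U → U) (hinv : ∀ x, f (f x) = x) (e : U)
    (T : Set (U × U × U))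
    (hip : ∀ a b c : U, (a, b, c) ∈ T → (f a, c, b) ∈ T ∧ (c, f b, a) ∈ T) :
    (∀ a b : U, a = b ↔ (a, e, b) ∈ T) ↔
    (f e = e ∧
      {C : Set (U × U × U) | (∃ a b c, C = cycleS f a b c) ∧
          (∃ t ∈ C, t.1 = e ∨ t.2.1 = e ∨ t.2.2 = e) ∧ C ⊆ T} =
        {C | ∃ a : U, C = cycleS f a e a}) := by
  constructor
  · intro hII
    have hee : (e, e, e) ∈ T := (hII e e).1 rfl
    refine ⟨(hII _ _).2 (hip _ _ _ hee).1, Set.ext fun C => ⟨?_, ?_⟩⟩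
    · rintro ⟨⟨a, b, c, rfl⟩, hid, hT⟩
      obtain ⟨x, z, hxz⟩ := exists_mid_mem_cycleS hinv hid
      obtain rfl := (hII x z).2 (hT hxz)
      exact ⟨x, cycleS_eq_of_mem hinv hxz⟩
    · rintro ⟨a, rfl⟩
      exact ⟨⟨a, e, a, rfl⟩, ⟨(a, e, a), by simp [cycleS], by simp⟩,
        cycleS_subset_of_mem hip ((hII a a).1 rfl)⟩
  · rintro ⟨hfe, hC⟩ a b
    constructor
    · rintro rfl
      have ha : cycleS f a e a ∈ {C | ∃ a : U, C = cycleS f a e a} := ⟨a, rfl⟩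
      rw [← hC] at ha
      exact ha.2.2 (by simp [cycleS])
    · intro hab
      have hmem : (a, e, b) ∈ cycleS f a e b := by simp [cycleS]
      obtain ⟨d, hd⟩ := hC.subset ⟨⟨a, e, b, rfl⟩, ⟨(a, e, b), hmem, by simp⟩,
        cycleS_subset_of_mem hip hab⟩
      rw [hd] at hmem
      simp only [cycleS, Set.mem_insert_iff, Set.mem_singleton_iff, Prod.mk.injEq] at hmem
      grind
end

section
/- Let (U, f, I, T) be a finite FAS structure. On the powerset ℘(U) define X·Y := {c ∈ U : ∃ a ∈ X, ∃ b ∈ Y, (a,b,c) ∈ T}, X⌣ := f[X] (the image of X under f), and take I as the identity constant. Then ⟨℘(U); ∪, ∩, complement, ∅, U, ·, ⌣, I⟩ is a nonassociative relation algebra: I is a two-sided identity for · and the triangle laws hold, i.e., for all X,Y,Z ⊆ U, X·Y ∩ Z = ∅ ⟺ X⌣·Z ∩ Y = ∅ ⟺ Z·Y⌣ ∩ X = ∅. -/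
/-- Complex composition: `X·Y = {c : ∃ a ∈ X, ∃ b ∈ Y, (a,b,c) ∈ T}`. -/
def comp {U : Type*} (T : Set (U × U × U)) (X Y : Set U) : Set U :=
  {c | ∃ a ∈ X, ∃ b ∈ Y, (a, b, c) ∈ T}

section FAS

variable {U : Type*} {f : U → U} {I : Set U} {T : Set (U × U × U)}

/-- The map of an FAS structure is an involution (finiteness is not needed). -/
theorem involutive_of_fas
    (hP : ∀ a b c : U, (a, b, c) ∈ T → (f a, c, b) ∈ T ∧ (c, f b, a) ∈ T)
    (hI : ∀ a b : U, a = b ↔ ∃ i ∈ I, (a, i, b) ∈ T) : Function.Involutive f := by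
  intro a
  obtain ⟨i, hi, h⟩ := (hI a a).1 rfl
  exact (hI _ _).2 ⟨i, hi, (hP _ _ _ (hP _ _ _ h).1).1⟩

/-- In an FAS structure, the elements of `I` also act as identities on the left. -/
theorem eq_iff_exists_left_of_fas
    (hP : ∀ a b c : U, (a, b, c) ∈ T → (f a, c, b) ∈ T ∧ (c, f b, a) ∈ T)
    (hI : ∀ a b : U, a = b ↔ ∃ i ∈ I, (a, i, b) ∈ T) (a b : U) :
    a = b ↔ ∃ i ∈ I, (i, a, b) ∈ T := by
  have hf := involutive_of_fas hP hI
  constructor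
  · rintro rfl
    obtain ⟨i, hi, h⟩ := (hI (f a) (f a)).1 rfl
    have h' := (hP _ _ _ (hP _ _ _ h).1).2
    rw [hf a] at h'
    exact ⟨i, hi, h'⟩
  · rintro ⟨i, hi, h⟩
    exact hf.injective ((hI _ _).2 ⟨i, hi, (hP _ _ _ (hP _ _ _ h).2).1⟩).symm

/-- Disjointness from a complex product, in terms of triples. -/
theorem comp_inter_eq_empty_iff {X Y Z : Set U} :
    comp T X Y ∩ Z = ∅ ↔ ∀ a ∈ X, ∀ b ∈ Y, ∀ c ∈ Z, (a, b, c) ∉ T := by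
  rw [Set.eq_empty_iff_forall_notMem]
  constructor
  · exact fun h a ha b hb c hc ht => h c ⟨⟨a, ha, b, hb, ht⟩, hc⟩
  · rintro h c ⟨⟨a, ha, b, hb, ht⟩, hc⟩
    exact h a ha b hb c hc ht

end FAS

/-- The complex algebra of a finite FAS structure is a nonassociative relation
algebra: `I` is a two-sided identity for complex composition and the triangle
laws hold (the Boolean operations being those of the powerset algebra, and
converse being `X ↦ f[X]`). -/
theorem stmt18 {U : Type*} [Finite U] (f : U → U) (I : Set U)
    (T : Set (U × U × U))
    (hP : ∀ a b c : U, (a, b, c) ∈ T → (f a, c, b) ∈ T ∧ (c, f b, a) ∈ T)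
    (hI : ∀ a b : U, a = b ↔ ∃ i ∈ I, (a, i, b) ∈ T) :
    (∀ X : Set U, comp T X I = X ∧ comp T I X = X) ∧
    (∀ X Y Z : Set U,
      (comp T X Y ∩ Z = ∅ ↔ comp T (f '' X) Z ∩ Y = ∅) ∧
      (comp T X Y ∩ Z = ∅ ↔ comp T Z (f '' Y) ∩ X = ∅)) := by
  have hf := involutive_of_fas hP hI
  refine ⟨fun X => ⟨?_, ?_⟩, fun X Y Z => ⟨?_, ?_⟩⟩
  · ext c
    constructor
    · rintro ⟨a, ha, i, hi, h⟩
      exact (hI a c).2 ⟨i, hi, h⟩ ▸ ha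
    · intro hc
      obtain ⟨i, hi, h⟩ := (hI c c).1 rfl
      exact ⟨c, hc, i, hi, h⟩
  · ext c
    constructor
    · rintro ⟨i, hi, a, ha, h⟩
      exact (eq_iff_exists_left_of_fas hP hI a c).2 ⟨i, hi, h⟩ ▸ ha
    · intro hc
      obtain ⟨i, hi, h⟩ := (eq_iff_exists_left_of_fas hP hI c c).1 rfl
      exact ⟨i, hi, c, hc, h⟩
  · simp only [comp_inter_eq_empty_iff, Set.forall_mem_image]
    constructor
    · intro h a ha c hc b hb ht
      have h' := (hP _ _ _ ht).1
      rw [hf a] at h'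
      exact h a ha b hb c hc h'
    · exact fun h a ha b hb c hc ht => h ha c hc b hb (hP _ _ _ ht).1
  · simp only [comp_inter_eq_empty_iff, Set.forall_mem_image]
    constructor
    · intro h c hc b hb a ha ht
      have h' := (hP _ _ _ ht).2
      rw [hf b] at h'
      exact h a ha b hb c hc h'
    · exact fun h a ha b hb c hc ht => h c hc hb a ha (hP _ _ _ ht).2
end
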